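/- arXiv:1102.0770 — 9 statements merged into one kernel-verified Lean document; each statement's English description precedes it below -/
import Mathlib

section
/- Let V and W be finite-dimensional complex inner product spaces and let H be a self-adjoint operator on V ⊗ W, written as H = Σ_α A_α ⊗ B_α with A_α ∈ End(V), B_α ∈ End(W) and the finite family {B_α} linearly independent. Then the unital subalgebra of End(V) generated by {A_α} is closed under taking adjoints. (Fact 2.9: the algebra induced by a Hermitian operator is closed under the adjoint operation.) -/
open Matrix Kronecker

/-- A linearly independent family over a field admits dual linear functionals. -/
lemma LinearIndependent.exists_dual_eq_single {K V ι : Type*} [Field K] [AddCommGroup V]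
    [Module K V] {v : ι → V} (hv : LinearIndependent K v) (i : ι) :
    ∃ f : V →ₗ[K] K, ∀ j, f (v j) = Finsupp.single j (1 : K) i := by
  obtain ⟨g, hg⟩ := LinearMap.exists_leftInverse_of_injective
    (Finsupp.linearCombination K v) (LinearMap.ker_eq_bot.mpr hv)
  refine ⟨Finsupp.lapply i ∘ₗ g, fun j => ?_⟩
  have h := LinearMap.congr_fun hg (Finsupp.single j 1)
  simp only [LinearMap.comp_apply, Finsupp.linearCombination_single, one_smul,
    LinearMap.id_apply] at h
  simp [h]

/-- If `∑ α, A α ⊗ₖ B α` is Hermitian and `B` is linearly independent, the adjoint of each `A α`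
is a linear combination of the family `A`. -/
lemma Matrix.star_mem_span_range_of_isHermitian_sum_kronecker {m n ι : Type*} [Fintype ι]
    {A : ι → Matrix m m ℂ} {B : ι → Matrix n n ℂ} (hB : LinearIndependent ℂ B)
    (hH : (∑ α, A α ⊗ₖ B α).IsHermitian) (α : ι) :
    star (A α) ∈ Submodule.span ℂ (Set.range A) := by
  classical
  obtain ⟨f, hf⟩ := hB.exists_dual_eq_single α
  have hslice (i j : m) : ∑ β, A β j i • B β = ∑ β, star (A β i j) • (B β)ᴴ := by
    ext p q
    simpa [Matrix.sum_apply] using (hH.apply (j, p) (i, q)).symm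
  have hstar : star (A α) = ∑ β, star (f (B β)ᴴ) • A β := by
    ext i j
    have h := congrArg (star ∘ f) (hslice i j)
    simpa [hf, Finsupp.single_apply, apply_ite, Matrix.sum_apply, mul_comm] using h
  rw [hstar]
  exact Submodule.sum_mem _ fun β _ =>
    Submodule.smul_mem _ _ (Submodule.subset_span (Set.mem_range_self β))

/-- Fact 2.9.  If `H` is a self-adjoint (Hermitian) operator on `V ⊗ W`
(modeled as a matrix on the product index), written as `H = Σ_α A_α ⊗ B_α` with the family
`{B_α} ⊆ End(W)` linearly independent, then the unital subalgebra of `End(V)` generated by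
`{A_α}` (the algebra induced by `H` on `V`) is closed under taking adjoints. -/
theorem induced_algebra_of_hermitian_closed_under_adjoint
    {dV dW : ℕ} {ι : Type} [Fintype ι]
    (H : Matrix (Fin dV × Fin dW) (Fin dV × Fin dW) ℂ)
    (A : ι → Matrix (Fin dV) (Fin dV) ℂ) (B : ι → Matrix (Fin dW) (Fin dW) ℂ)
    (hB : LinearIndependent ℂ B)
    (hdec : H = ∑ α, (A α) ⊗ₖ (B α))
    (hsa : H.IsHermitian) :
    ∀ x ∈ Algebra.adjoin ℂ (Set.range A), star x ∈ Algebra.adjoin ℂ (Set.range A) := by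
  subst hdec
  intro x hx
  induction hx using Algebra.adjoin_induction with
  | mem x hx =>
    obtain ⟨α, rfl⟩ := hx
    exact Algebra.span_le_adjoin ℂ _
      (Matrix.star_mem_span_range_of_isHermitian_sum_kronecker hB hsa α)
  | algebraMap r =>
    rw [← algebraMap_star_comm]
    exact Subalgebra.algebraMap_mem _ _
  | add x y _ _ hx hy =>
    rw [star_add]
    exact add_mem hx hy
  | mul x y _ _ hx hy =>
    rw [star_mul]
    exact mul_mem hy hx
end

section
/- Let H_q, E₁, E₂ be finite-dimensional complex vector spaces. Let H₁ = Σ_α A_α ⊗ B_α ⊗ I_{E₂} and H₂ = Σ_β C_β ⊗ I_{E₁} ⊗ D_β be operators on H_q ⊗ E₁ ⊗ E₂, where A_α, C_β ∈ End(H_q), the finite family {B_α} ⊆ End(E₁) is linearly independent, and the finite family {D_β} ⊆ End(E₂) is linearly independent. If H₁ and H₂ commute, then A_α C_β = C_β A_α for all α and β; consequently the algebra induced by H₁ on H_q and the algebra induced by H₂ on H_q commute elementwise. (Fact 2.10: two commuting operators intersecting only on the qudit q induce commuting algebras on q.) -/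
open Matrix Kronecker

/-- If `B` is linearly independent, then `∑ i, X i ⊗ₖ B i` vanishes only when every `X i` does. -/
theorem Matrix.eq_zero_of_sum_kronecker_eq_zero {R ι l m n p : Type*} [CommSemiring R]
    [Fintype ι] {X : ι → Matrix l m R} {B : ι → Matrix n p R} (hB : LinearIndependent R B)
    (h : ∑ i, X i ⊗ₖ B i = 0) (i : ι) : X i = 0 := by
  ext a b
  refine Fintype.linearIndependent_iffₛ.mp hB (fun i => X i a b) 0 ?_ i
  ext c d
  simpa [Matrix.sum_apply] using congr_fun₂ h (a, c) (b, d)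

/-- Fact 2.10.  Let `H₁ = Σ_α A_α ⊗ B_α ⊗ I` and `H₂ = Σ_β C_β ⊗ I ⊗ D_β`
be operators on `H_q ⊗ E₁ ⊗ E₂` (modeled via Kronecker products of matrices), where the
families `{B_α} ⊆ End(E₁)` and `{D_β} ⊆ End(E₂)` are each linearly independent.  If `H₁` and
`H₂` commute, then `A_α` commutes with `C_β` for all `α, β`; consequently the algebra induced
by `H₁` on `H_q` and the algebra induced by `H₂` on `H_q` commute elementwise. -/
theorem commuting_operators_induce_commuting_algebras
    {dq e₁ e₂ : ℕ} {ι κ : Type} [Fintype ι] [Fintype κ]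
    (A : ι → Matrix (Fin dq) (Fin dq) ℂ) (B : ι → Matrix (Fin e₁) (Fin e₁) ℂ)
    (C : κ → Matrix (Fin dq) (Fin dq) ℂ) (D : κ → Matrix (Fin e₂) (Fin e₂) ℂ)
    (hB : LinearIndependent ℂ B) (hD : LinearIndependent ℂ D)
    (hcomm : Commute
      (∑ α, ((A α) ⊗ₖ (B α)) ⊗ₖ (1 : Matrix (Fin e₂) (Fin e₂) ℂ))
      (∑ β, ((C β) ⊗ₖ (1 : Matrix (Fin e₁) (Fin e₁) ℂ)) ⊗ₖ (D β))) :
    (∀ α β, Commute (A α) (C β)) ∧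
      ∀ x ∈ Algebra.adjoin ℂ (Set.range A), ∀ y ∈ Algebra.adjoin ℂ (Set.range C),
        Commute x y := by
  have hsum : ∑ β, (∑ α, (A α * C β - C β * A α) ⊗ₖ B α) ⊗ₖ D β = 0 := by
    have h := sub_eq_zero.mpr hcomm.eq
    simp only [Finset.sum_mul_sum, ← mul_kronecker_mul, one_mul, mul_one] at h
    rw [Finset.sum_comm, ← Finset.sum_sub_distrib] at h
    rw [← h]
    refine Finset.sum_congr rfl fun β _ => ?_
    rw [← Finset.sum_sub_distrib]
    ext ⟨⟨a, b⟩, c⟩ ⟨⟨a', b'⟩, c'⟩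
    simp only [kronecker_apply, Matrix.sum_apply, Matrix.sub_apply, Finset.sum_mul, sub_mul]
  have hAC : ∀ α β, Commute (A α) (C β) := fun α β =>
    sub_eq_zero.mp <| eq_zero_of_sum_kronecker_eq_zero hB
      (eq_zero_of_sum_kronecker_eq_zero hD hsum β) α
  refine ⟨hAC, fun x hx y hy => ?_⟩
  refine Algebra.commute_of_mem_adjoin_of_forall_mem_commute hy ?_
  rintro _ ⟨β, rfl⟩
  refine (Algebra.commute_of_mem_adjoin_of_forall_mem_commute hx ?_).symm
  rintro _ ⟨α, rfl⟩
  exact (hAC α β).symm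
end

section
/- Let H_q, E₁, E₂ be finite-dimensional complex Hilbert spaces with dim H_q = 2. Let H₁ = H̃₁ ⊗ I_{E₂} for a self-adjoint operator H̃₁ on H_q ⊗ E₁, and let H₂ be the operator on H_q ⊗ E₁ ⊗ E₂ corresponding, under the canonical permutation of tensor factors, to H̃₂ ⊗ I_{E₁} for a self-adjoint operator H̃₂ on H_q ⊗ E₂. Assume H₁ and H₂ commute and that each of H₁ and H₂ acts nontrivially on H_q. Then there exists an orthonormal basis {v₀, v₁} of H_q such that both H₁ and H₂ commute with (the orthogonal projection onto ℂv₀) ⊗ I_{E₁⊗E₂}; equivalently, H_q decomposes into a direct sum of two one-dimensional subspaces each of which is preserved by both operators. (Claim 4.4: a butterfly pair of commuting operators on a qubit admits a common nontrivial one-dimensional decomposition.) -/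
open Matrix Kronecker

/-- The operator `M ⊗ I_{E₂}` on `H_q ⊗ E₁ ⊗ E₂`, for `M` an operator on `H_q ⊗ E₁`. -/
def liftL {dq e₁ e₂ : ℕ} (M : Matrix (Fin dq × Fin e₁) (Fin dq × Fin e₁) ℂ) :
    Matrix (Fin dq × Fin e₁ × Fin e₂) (Fin dq × Fin e₁ × Fin e₂) ℂ :=
  Matrix.of fun p q =>
    M (p.1, p.2.1) (q.1, q.2.1) * (if p.2.2 = q.2.2 then 1 else 0)

/-- The operator on `H_q ⊗ E₁ ⊗ E₂` corresponding, under the canonical permutation of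
tensor factors, to `M ⊗ I_{E₁}` for `M` an operator on `H_q ⊗ E₂`. -/
def liftR {dq e₁ e₂ : ℕ} (M : Matrix (Fin dq × Fin e₂) (Fin dq × Fin e₂) ℂ) :
    Matrix (Fin dq × Fin e₁ × Fin e₂) (Fin dq × Fin e₁ × Fin e₂) ℂ :=
  Matrix.of fun p q =>
    M (p.1, p.2.2) (q.1, q.2.2) * (if p.2.1 = q.2.1 then 1 else 0)

/-- An operator on `H_q ⊗ E` acts trivially on the first tensor factor `H_q` if it can be
written as `I_{H_q} ⊗ B` for some operator `B` on `E`. -/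
def ActsTrivFst {dq : ℕ} {β : Type} (M : Matrix (Fin dq × β) (Fin dq × β) ℂ) : Prop :=
  ∃ B : Matrix β β ℂ, ∀ p q, M p q = (if p.1 = q.1 then (1 : ℂ) else 0) * B p.2 q.2

/-- The `(i, j)` block of an operator on `H_q ⊗ E`, as an operator on `H_q`. -/
def fstBlock {n β : Type} (M : Matrix (n × β) (n × β) ℂ) (i j : β) : Matrix n n ℂ :=
  Matrix.of fun a b => M (a, i) (b, j)

/-- A `2 × 2` matrix is scalar if it is diagonal with equal diagonal entries. -/
def IsScalarTwo (A : Matrix (Fin 2) (Fin 2) ℂ) : Prop :=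
  A 0 1 = 0 ∧ A 1 0 = 0 ∧ A 0 0 = A 1 1

theorem fstBlock_conjTranspose {n β : Type} {M : Matrix (n × β) (n × β) ℂ}
    (hM : M.IsHermitian) (i j : β) : (fstBlock M i j)ᴴ = fstBlock M j i := by
  ext a b
  exact hM.apply (a, j) (b, i)

/-- The commutant of a non-scalar `2 × 2` matrix is commutative. -/
theorem commute_of_commute_of_not_isScalarTwo {A X Y : Matrix (Fin 2) (Fin 2) ℂ}
    (hA : ¬ IsScalarTwo A) (hX : Commute A X) (hY : Commute A Y) : Commute X Y := by
  have x (i j) := congrFun (congrFun hX.eq i) j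
  have y (i j) := congrFun (congrFun hY.eq i) j
  have x00 := x 0 0
  have x01 := x 0 1
  have x10 := x 1 0
  have y00 := y 0 0
  have y01 := y 0 1
  have y10 := y 1 0
  simp only [mul_apply, Fin.sum_univ_two] at x00 x01 x10 y00 y01 y10
  have h1 : X 0 1 * Y 1 0 = Y 0 1 * X 1 0 := by
    unfold IsScalarTwo at hA; grind
  have h2 : X 0 1 * (Y 0 0 - Y 1 1) = Y 0 1 * (X 0 0 - X 1 1) := by
    unfold IsScalarTwo at hA; grind
  have h3 : X 1 0 * (Y 0 0 - Y 1 1) = Y 1 0 * (X 0 0 - X 1 1) := by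
    unfold IsScalarTwo at hA; grind
  ext i j
  fin_cases i <;> fin_cases j <;> simp [mul_apply, Fin.sum_univ_two] <;> grind

/-- If `B` is not scalar then its real or its imaginary part is not scalar. -/
theorem exists_isHermitian_not_isScalarTwo {B : Matrix (Fin 2) (Fin 2) ℂ}
    (hB : ¬ IsScalarTwo B) :
    ∃ N : Matrix (Fin 2) (Fin 2) ℂ, N.IsHermitian ∧ ¬ IsScalarTwo N ∧
      ∀ X, Commute X B → Commute X Bᴴ → Commute X N := by
  by_cases h : IsScalarTwo (B + Bᴴ)
  · refine ⟨Complex.I • (B - Bᴴ), ?_, ?_, fun X h₁ h₂ => (h₁.sub_right h₂).smul_right _⟩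
    · simp [IsHermitian, conjTranspose_smul, ← smul_neg]
    · intro h'
      apply hB
      simp only [IsScalarTwo, Matrix.add_apply, Matrix.smul_apply, Matrix.sub_apply,
        smul_eq_mul, mul_eq_zero, Complex.I_ne_zero, false_or,
        mul_right_inj' Complex.I_ne_zero] at h h' ⊢
      grind
  · exact ⟨B + Bᴴ, isHermitian_add_transpose_self B, h, fun X h₁ h₂ => h₁.add_right h₂⟩

/-- The spectral projection of a non-scalar Hermitian `2 × 2` matrix onto an eigenvector commutes
with everything that commutes with the matrix. -/
theorem exists_orthonormal_commute_vecMulVec {N : Matrix (Fin 2) (Fin 2) ℂ}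
    (hN : N.IsHermitian) (hs : ¬ IsScalarTwo N) :
    ∃ v₀ v₁ : Fin 2 → ℂ, star v₀ ⬝ᵥ v₀ = 1 ∧ star v₁ ⬝ᵥ v₁ = 1 ∧ star v₀ ⬝ᵥ v₁ = 0 ∧
      ∀ X, Commute X N → Commute X (vecMulVec v₀ (star v₀)) := by
  obtain ⟨U, d, hU, hU', hd⟩ : ∃ (U : Matrix (Fin 2) (Fin 2) ℂ) (d : Fin 2 → ℂ),
      Uᴴ * U = 1 ∧ U * Uᴴ = 1 ∧ N = U * diagonal d * Uᴴ := by
    refine ⟨hN.eigenvectorUnitary, fun i => (hN.eigenvalues i : ℂ),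
      Unitary.coe_star_mul_self hN.eigenvectorUnitary,
      Unitary.coe_mul_star_self hN.eigenvectorUnitary, ?_⟩
    conv_lhs => rw [hN.spectral_theorem, Unitary.conjStarAlgAut_apply]
    rfl
  have orth (i j) := congrFun (congrFun hU i) j
  have hP : N = d 1 • (1 : Matrix (Fin 2) (Fin 2) ℂ) +
      (d 0 - d 1) • vecMulVec (fun a => U a 0) (star fun a => U a 0) := by
    rw [← hU', hd]
    ext a b
    simp [mul_apply, vecMulVec_apply, diagonal_apply, Fin.sum_univ_two]
    ring
  have hne : d 0 - d 1 ≠ 0 := by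
    intro h
    apply hs
    rw [hP, h]
    simp [IsScalarTwo]
  refine ⟨fun a => U a 0, fun a => U a 1, ?_, ?_, ?_, fun X hX => ?_⟩
  · simpa [mul_apply, dotProduct] using orth 0 0
  · simpa [mul_apply, dotProduct] using orth 1 1
  · simpa [mul_apply, dotProduct] using orth 0 1
  · have h := (hX.sub_right ((Commute.one_right X).smul_right (d 1))).smul_right (d 0 - d 1)⁻¹
    rwa [hP, add_sub_cancel_left, inv_smul_smul₀ hne] at h

theorem commute_fstBlock_of_commute_lift {dq e₁ e₂ : ℕ}
    {M : Matrix (Fin dq × Fin e₁) (Fin dq × Fin e₁) ℂ}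
    {M' : Matrix (Fin dq × Fin e₂) (Fin dq × Fin e₂) ℂ}
    (h : Commute (liftL (e₂ := e₂) M) (liftR (e₁ := e₁) M')) (i j : Fin e₁) (k l : Fin e₂) :
    Commute (fstBlock M i j) (fstBlock M' k l) := by
  ext a b
  have := congrFun (congrFun h.eq (a, i, k)) (b, j, l)
  simpa [mul_apply, Fintype.sum_prod_type, liftL, liftR, fstBlock] using this

theorem commute_liftL_kronecker_one {dq e₁ e₂ : ℕ}
    {M : Matrix (Fin dq × Fin e₁) (Fin dq × Fin e₁) ℂ} {P : Matrix (Fin dq) (Fin dq) ℂ}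
    (h : ∀ i j, Commute (fstBlock M i j) P) :
    Commute (liftL (e₂ := e₂) M)
      (P ⊗ₖ (1 : Matrix (Fin e₁ × Fin e₂) (Fin e₁ × Fin e₂) ℂ)) := by
  ext ⟨a, i, k⟩ ⟨b, j, l⟩
  have := congrFun (congrFun (h i j).eq a) b
  by_cases hkl : k = l
  · simpa [mul_apply, Fintype.sum_prod_type, liftL, fstBlock, one_apply, Prod.ext_iff, ite_and,
      hkl] using this
  · simp [mul_apply, Fintype.sum_prod_type, liftL, one_apply, Prod.ext_iff, ite_and, hkl]

theorem commute_liftR_kronecker_one {dq e₁ e₂ : ℕ}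
    {M : Matrix (Fin dq × Fin e₂) (Fin dq × Fin e₂) ℂ} {P : Matrix (Fin dq) (Fin dq) ℂ}
    (h : ∀ i j, Commute (fstBlock M i j) P) :
    Commute (liftR (e₁ := e₁) M)
      (P ⊗ₖ (1 : Matrix (Fin e₁ × Fin e₂) (Fin e₁ × Fin e₂) ℂ)) := by
  ext ⟨a, i, k⟩ ⟨b, j, l⟩
  have := congrFun (congrFun (h k l).eq a) b
  by_cases hij : i = j
  · simpa [mul_apply, Fintype.sum_prod_type, liftR, fstBlock, one_apply, Prod.ext_iff, ite_and,
      hij] using this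
  · simp [mul_apply, Fintype.sum_prod_type, liftR, one_apply, Prod.ext_iff, ite_and, hij]

theorem actsTrivFst_of_isScalarTwo_fstBlock {β : Type}
    {M : Matrix (Fin 2 × β) (Fin 2 × β) ℂ} (h : ∀ i j, IsScalarTwo (fstBlock M i j)) :
    ActsTrivFst M := by
  refine ⟨fun i j => M (0, i) (0, j), ?_⟩
  rintro ⟨a, i⟩ ⟨b, j⟩
  obtain ⟨h₁, h₂, h₃⟩ := h i j
  simp only [fstBlock, of_apply] at h₁ h₂ h₃
  fin_cases a <;> fin_cases b <;> simp [h₁, h₂, h₃]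

theorem exists_not_isScalarTwo_of_liftL {e₁ e₂ : ℕ}
    {M : Matrix (Fin 2 × Fin e₁) (Fin 2 × Fin e₁) ℂ}
    (h : ¬ ActsTrivFst (liftL (e₂ := e₂) M)) : ∃ i j, ¬ IsScalarTwo (fstBlock M i j) := by
  by_contra! hs
  refine h (actsTrivFst_of_isScalarTwo_fstBlock fun p q => ?_)
  obtain ⟨h₁, h₂, h₃⟩ := hs p.1 q.1
  simp only [fstBlock, of_apply] at h₁ h₂ h₃
  simp [IsScalarTwo, fstBlock, liftL, h₁, h₂, h₃]

theorem exists_not_isScalarTwo_of_liftR {e₁ e₂ : ℕ}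
    {M : Matrix (Fin 2 × Fin e₂) (Fin 2 × Fin e₂) ℂ}
    (h : ¬ ActsTrivFst (liftR (e₁ := e₁) M)) : ∃ i j, ¬ IsScalarTwo (fstBlock M i j) := by
  by_contra! hs
  refine h (actsTrivFst_of_isScalarTwo_fstBlock fun p q => ?_)
  obtain ⟨h₁, h₂, h₃⟩ := hs p.2 q.2
  simp only [fstBlock, of_apply] at h₁ h₂ h₃
  simp [IsScalarTwo, fstBlock, liftR, h₁, h₂, h₃]


/-- Claim 4.4.  Let `dim H_q = 2`, let `H₁ = H̃₁ ⊗ I_{E₂}` and let `H₂`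
correspond to `H̃₂ ⊗ I_{E₁}` with `H̃₁, H̃₂` self-adjoint; if `H₁` and `H₂` commute and each
acts nontrivially on `H_q`, then there is an orthonormal basis `{v₀, v₁}` of `H_q` such that
both `H₁` and `H₂` commute with `(projection onto ℂv₀) ⊗ I`; i.e. `H_q` decomposes into two
one-dimensional subspaces preserved by both operators. -/
theorem butterfly_common_decomposition_qubit {e₁ e₂ : ℕ}
    (H1 : Matrix (Fin 2 × Fin e₁) (Fin 2 × Fin e₁) ℂ)
    (H2 : Matrix (Fin 2 × Fin e₂) (Fin 2 × Fin e₂) ℂ)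
    (h1sa : H1.IsHermitian) (h2sa : H2.IsHermitian)
    (hcomm : Commute (liftL (e₂ := e₂) H1) (liftR (e₁ := e₁) H2))
    (h1nt : ¬ ActsTrivFst (liftL (e₂ := e₂) H1))
    (h2nt : ¬ ActsTrivFst (liftR (e₁ := e₁) H2)) :
    ∃ v₀ v₁ : Fin 2 → ℂ,
      star v₀ ⬝ᵥ v₀ = 1 ∧ star v₁ ⬝ᵥ v₁ = 1 ∧ star v₀ ⬝ᵥ v₁ = 0 ∧
      Commute (liftL (e₂ := e₂) H1)
        ((vecMulVec v₀ (star v₀)) ⊗ₖ (1 : Matrix (Fin e₁ × Fin e₂) (Fin e₁ × Fin e₂) ℂ)) ∧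
      Commute (liftR (e₁ := e₁) H2)
        ((vecMulVec v₀ (star v₀)) ⊗ₖ (1 : Matrix (Fin e₁ × Fin e₂) (Fin e₁ × Fin e₂) ℂ)) := by
  obtain ⟨i, j, hA⟩ := exists_not_isScalarTwo_of_liftL h1nt
  obtain ⟨k, l, hB⟩ := exists_not_isScalarTwo_of_liftR h2nt
  have hAB := commute_fstBlock_of_commute_lift hcomm
  obtain ⟨N, hN, hNs, hNc⟩ := exists_isHermitian_not_isScalarTwo hB
  rw [fstBlock_conjTranspose h2sa] at hNc
  have hAN (i j) : Commute (fstBlock H1 i j) N := hNc _ (hAB i j k l) (hAB i j l k)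
  obtain ⟨v₀, v₁, h₀, h₁, h₀₁, hv⟩ := exists_orthonormal_commute_vecMulVec hN hNs
  refine ⟨v₀, v₁, h₀, h₁, h₀₁, commute_liftL_kronecker_one fun a b => hv _ (hAN a b),
    commute_liftR_kronecker_one fun a b => hv _ ?_⟩
  exact commute_of_commute_of_not_isScalarTwo hA (hAB i j a b) (hAN i j)
end

section
/- Let E be a finite-dimensional complex vector space, let {e₀, e₁} be an orthonormal basis of ℂ², and let P_u denote the orthogonal projection of ℂ² onto the line ℂu. Suppose an operator H on ℂ² ⊗ E satisfies both H = P_{e₀} ⊗ M₀ + P_{e₁} ⊗ M₁ and H = P_v ⊗ N₀ + P_w ⊗ N₁, where M₀, M₁, N₀, N₁ are operators on E, {v, w} is an orthonormal basis of ℂ², and v = α e₀ + β e₁ with α ≠ 0 and β ≠ 0. Then N₀ = N₁ and M₀ = M₁, and hence H = I_{ℂ²} ⊗ N₀; in particular H acts trivially on the qubit factor. (Claim 4.6: a qubit admits at most one decomposition in which an operator acting nontrivially on it is block diagonal, i.e., the butterfly-induced decomposition is unique.) -/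
open Matrix Kronecker

/-- The projections onto the two lines of an orthonormal basis of `ℂ²` sum to the identity. -/
lemma vecMulVec_star_add_vecMulVec_star_eq_one {v w : Fin 2 → ℂ}
    (hv : star v ⬝ᵥ v = 1) (hw : star w ⬝ᵥ w = 1) (hvw : star v ⬝ᵥ w = 0) :
    vecMulVec v (star v) + vecMulVec w (star w) = 1 := by
  have hwv : star w ⬝ᵥ v = 0 := by
    rw [star_dotProduct, hvw, star_zero]
  have hU : (of ![v, w]).map star * (of ![v, w])ᵀ = 1 := by
    ext i j
    have h : ((of ![v, w]).map star * (of ![v, w])ᵀ) i j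
        = star (![v, w] i) ⬝ᵥ ![v, w] j := rfl
    rw [h]
    fin_cases i <;> fin_cases j <;> simp [hv, hw, hvw, hwv]
  rw [← mul_eq_one_comm.mp hU]
  ext i j
  simp [vecMulVec_apply, mul_apply]

/-- Sandwiching a rank-one matrix between two vectors. -/
lemma dotProduct_vecMulVec_mulVec {n R : Type*} [Fintype n] [CommSemiring R] (x y u z : n → R) :
    x ⬝ᵥ (vecMulVec u z *ᵥ y) = (x ⬝ᵥ u) * (z ⬝ᵥ y) := by
  rw [vecMulVec_mulVec, op_smul_eq_smul, dotProduct_smul, smul_eq_mul, mul_comm]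

/-- A matrix on `ℂ²` that is diagonal in two orthonormal bases `{e₀, e₁}` and `{v, w}`, with `v`
proportional to neither `e₀` nor `e₁`, is scalar. -/
lemma eq_of_smul_vecMulVec_add_eq {e₀ e₁ v w : Fin 2 → ℂ}
    (he₀ : star e₀ ⬝ᵥ e₀ = 1) (he₁ : star e₁ ⬝ᵥ e₁ = 1) (he₀₁ : star e₀ ⬝ᵥ e₁ = 0)
    (hv : star v ⬝ᵥ v = 1) (hw : star w ⬝ᵥ w = 1) (hvw : star v ⬝ᵥ w = 0)
    {α β : ℂ} (hα : α ≠ 0) (hβ : β ≠ 0) (hvdef : v = α • e₀ + β • e₁) {a b c d : ℂ}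
    (h : a • vecMulVec e₀ (star e₀) + b • vecMulVec e₁ (star e₁)
      = c • vecMulVec v (star v) + d • vecMulVec w (star w)) :
    c = d ∧ a = c ∧ b = c := by
  have he₁₀ : star e₁ ⬝ᵥ e₀ = 0 := by
    rw [star_dotProduct, he₀₁, star_zero]
  have hsum := vecMulVec_star_add_vecMulVec_star_eq_one hv hw hvw
  rw [← eq_sub_iff_add_eq'] at hsum
  have h₀v : star e₀ ⬝ᵥ v = α := by simp [hvdef, he₀, he₀₁]
  have hv₁ : star v ⬝ᵥ e₁ = star β := by simp [hvdef, he₁, he₀₁]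
  rw [hsum] at h
  have sandwich (x y : Fin 2 → ℂ) := congrArg (fun A ↦ x ⬝ᵥ (A *ᵥ y)) h
  simp only [add_mulVec, smul_mulVec, sub_mulVec, one_mulVec, dotProduct_add, dotProduct_sub,
    dotProduct_smul, dotProduct_vecMulVec_mulVec, smul_eq_mul] at sandwich
  have hcd : c = d := by
    have h₀₁ := sandwich (star e₀) e₁
    rw [he₀, he₁, he₀₁, h₀v, hv₁] at h₀₁
    have hαβ : α * star β ≠ 0 := mul_ne_zero hα (star_ne_zero.mpr hβ)
    exact mul_right_cancel₀ hαβ (by linear_combination -h₀₁)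
  subst hcd
  have h₀₀ := sandwich (star e₀) e₀
  have h₁₁ := sandwich (star e₁) e₁
  rw [he₀, he₀₁, he₁₀] at h₀₀
  rw [he₁, he₀₁, he₁₀] at h₁₁
  exact ⟨rfl, by linear_combination h₀₀, by linear_combination h₁₁⟩

/-- Claim 4.6.  Let `{e₀, e₁}` be an orthonormal basis of `ℂ²` and suppose
an operator `H` on `ℂ² ⊗ E` is block diagonal both with respect to `{e₀, e₁}` and with
respect to another orthonormal basis `{v, w}` where `v = α e₀ + β e₁` with `α ≠ 0 ≠ β`.
Then `N₀ = N₁`, `M₀ = M₁`, and `H = I ⊗ N₀`; in particular `H` acts trivially on the qubit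
factor.  (Here `P_u = vecMulVec u (star u)` is the orthogonal projection onto `ℂu` for a
unit vector `u`.) -/
theorem unique_block_diagonal_decomposition_qubit {e : ℕ}
    (e₀ e₁ v w : Fin 2 → ℂ)
    (he₀ : star e₀ ⬝ᵥ e₀ = 1) (he₁ : star e₁ ⬝ᵥ e₁ = 1) (he₀₁ : star e₀ ⬝ᵥ e₁ = 0)
    (hv : star v ⬝ᵥ v = 1) (hw : star w ⬝ᵥ w = 1) (hvw : star v ⬝ᵥ w = 0)
    (α β : ℂ) (hα : α ≠ 0) (hβ : β ≠ 0) (hvdef : v = α • e₀ + β • e₁)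
    (M₀ M₁ N₀ N₁ : Matrix (Fin e) (Fin e) ℂ)
    (H : Matrix (Fin 2 × Fin e) (Fin 2 × Fin e) ℂ)
    (hH1 : H = (vecMulVec e₀ (star e₀)) ⊗ₖ M₀ + (vecMulVec e₁ (star e₁)) ⊗ₖ M₁)
    (hH2 : H = (vecMulVec v (star v)) ⊗ₖ N₀ + (vecMulVec w (star w)) ⊗ₖ N₁) :
    N₀ = N₁ ∧ M₀ = M₁ ∧ H = (1 : Matrix (Fin 2) (Fin 2) ℂ) ⊗ₖ N₀ := by
  have hentry (k l : Fin e) : N₀ k l = N₁ k l ∧ M₀ k l = N₀ k l ∧ M₁ k l = N₀ k l := by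
    refine eq_of_smul_vecMulVec_add_eq he₀ he₁ he₀₁ hv hw hvw hα hβ hvdef ?_
    ext i j
    have hij := congrFun₂ (hH1.symm.trans hH2) (i, k) (j, l)
    simp only [Matrix.add_apply, kronecker_apply] at hij
    simp only [Matrix.add_apply, Matrix.smul_apply, smul_eq_mul]
    linear_combination hij
  have hN : N₀ = N₁ := ext fun k l ↦ (hentry k l).1
  refine ⟨hN, ext fun k l ↦ (hentry k l).2.1.trans (hentry k l).2.2.symm, ?_⟩
  rw [hH2, ← hN, ← add_kronecker, vecMulVec_star_add_vecMulVec_star_eq_one hv hw hvw]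
end

section
/- Let H_1, …, H_n be finite-dimensional complex Hilbert spaces, let q be a distinguished index with dim H_q = 2, and let S be a finite set of pairwise commuting self-adjoint operators on H_1 ⊗ ⋯ ⊗ H_n. Assume that at least two elements of S act nontrivially on particle q and that every two elements of S acting nontrivially on q are butterfly-connected with respect to q. Then q is separable: there exists an orthonormal basis {v₀, v₁} of H_q such that every element of S commutes with (the orthogonal projection onto ℂv₀) ⊗ (identity on the remaining factors). (Theorem 4.1/4.8: butterfly connectedness of all operators on a qubit implies the qubit is separable.) -/
open Matrix

/-- An operator on the system of `n` particles (with particle `i` of dimension `d i`)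
acts trivially on particle `i` if it is the identity on `H_i` tensored with an operator on
the remaining factors. -/
def ActsTriviallyAt {n : ℕ} {d : Fin n → ℕ}
    (M : Matrix (∀ i, Fin (d i)) (∀ i, Fin (d i)) ℂ) (i : Fin n) : Prop :=
  ∃ N : Matrix (∀ j : {j : Fin n // j ≠ i}, Fin (d j.1))
      (∀ j : {j : Fin n // j ≠ i}, Fin (d j.1)) ℂ,
    ∀ x y, M x y = (if x i = y i then (1 : ℂ) else 0) * N (fun j => x j.1) (fun j => y j.1)

/-- The support of an operator: the set of particles on which it acts nontrivially. -/
def supp {n : ℕ} {d : Fin n → ℕ}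
    (M : Matrix (∀ i, Fin (d i)) (∀ i, Fin (d i)) ℂ) : Set (Fin n) :=
  {i | ¬ ActsTriviallyAt M i}

/-- The orthogonal projection onto `ℂv` at site `i`, tensored with the identity on all other
particles. -/
def projAt {n : ℕ} {d : Fin n → ℕ} (i : Fin n) (v : Fin (d i) → ℂ) :
    Matrix (∀ i, Fin (d i)) (∀ i, Fin (d i)) ℂ :=
  Matrix.of fun x y =>
    if Function.update x i (y i) = y then v (x i) * star (v (y i)) else 0

/-- A particle `q` (of dimension 2) is separable for `S` if there is an orthonormal basis
`{v₀, v₁}` of `H_q` such that every element of `S` commutes with the projection onto `ℂv₀`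
at site `q` (tensored with the identity elsewhere). -/
def SeparableAt {n : ℕ} {d : Fin n → ℕ}
    (S : Finset (Matrix (∀ i, Fin (d i)) (∀ i, Fin (d i)) ℂ)) (q : Fin n) : Prop :=
  ∃ v₀ v₁ : Fin (d q) → ℂ,
    star v₀ ⬝ᵥ v₀ = 1 ∧ star v₁ ⬝ᵥ v₁ = 1 ∧ star v₀ ⬝ᵥ v₁ = 0 ∧
    ∀ H ∈ S, Commute H (projAt q v₀)

/-- Two operators form a butterfly with respect to `q`: their supports intersect exactly in
`{q}` (in particular both act nontrivially on `q`). -/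
def Butterfly {n : ℕ} {d : Fin n → ℕ} (q : Fin n)
    (H₁ H₂ : Matrix (∀ i, Fin (d i)) (∀ i, Fin (d i)) ℂ) : Prop :=
  supp H₁ ∩ supp H₂ = {q}

/-- `H₁` and `H₂` are butterfly-connected with respect to `q` within `S`: there is a finite
chain of elements of `S`, each acting nontrivially on `q`, linking them by butterflies. -/
def ButterflyConnected {n : ℕ} {d : Fin n → ℕ}
    (S : Finset (Matrix (∀ i, Fin (d i)) (∀ i, Fin (d i)) ℂ)) (q : Fin n)
    (H₁ H₂ : Matrix (∀ i, Fin (d i)) (∀ i, Fin (d i)) ℂ) : Prop :=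
  ∃ (m : ℕ) (K : Fin (m + 1) → Matrix (∀ i, Fin (d i)) (∀ i, Fin (d i)) ℂ),
    K 0 = H₁ ∧ K (Fin.last m) = H₂ ∧
    (∀ i, K i ∈ S ∧ q ∈ supp (K i)) ∧
    ∀ i : Fin m, Butterfly q (K i.castSucc) (K i.succ)

section TwoByTwo

variable {k : ℕ}

/-- Commutation is transitive through a non-scalar `2 × 2` matrix. -/
theorem commute_of_commute_nonscalar (hk : k = 2) {A B C : Matrix (Fin k) (Fin k) ℂ}
    (hB : ¬ ∃ c : ℂ, B = c • 1) (hAB : Commute A B) (hBC : Commute B C) : Commute A C := by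
  subst hk
  have hB' : B 0 1 ≠ 0 ∨ B 1 0 ≠ 0 ∨ B 0 0 ≠ B 1 1 := by
    by_contra! h
    refine hB ⟨B 0 0, ?_⟩
    ext i j
    fin_cases i <;> fin_cases j <;> simp [h.1, h.2.1, h.2.2]
  have entries {X Y : Matrix (Fin 2) (Fin 2) ℂ} (h : Commute X Y) :
      X 0 1 * Y 1 0 = Y 0 1 * X 1 0 ∧
      (X 0 0 - X 1 1) * Y 0 1 = X 0 1 * (Y 0 0 - Y 1 1) ∧
      (X 0 0 - X 1 1) * Y 1 0 = X 1 0 * (Y 0 0 - Y 1 1) := by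
    have e (i j) := congrFun (congrFun h.eq i) j
    simp only [Matrix.mul_apply, Fin.sum_univ_two] at e
    have e00 := e 0 0
    have e01 := e 0 1
    have e10 := e 1 0
    refine ⟨by linear_combination e00, by linear_combination e01, by linear_combination -e10⟩
  obtain ⟨a1, a2, a3⟩ := entries hAB
  obtain ⟨c1, c2, c3⟩ := entries hBC
  have hAC : A 0 1 * C 1 0 = C 0 1 * A 1 0 ∧
      (A 0 0 - A 1 1) * C 0 1 = A 0 1 * (C 0 0 - C 1 1) ∧
      (A 0 0 - A 1 1) * C 1 0 = A 1 0 * (C 0 0 - C 1 1) := by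
    rcases hB' with h | h | h
    · refine ⟨mul_left_cancel₀ h ?_, mul_left_cancel₀ h ?_, mul_left_cancel₀ h ?_⟩ <;> grind
    · refine ⟨mul_left_cancel₀ h ?_, mul_left_cancel₀ h ?_, mul_left_cancel₀ h ?_⟩ <;> grind
    · have h := sub_ne_zero.2 h
      refine ⟨mul_left_cancel₀ h ?_, mul_left_cancel₀ h ?_, mul_left_cancel₀ h ?_⟩ <;> grind
  obtain ⟨h1, h2, h3⟩ := hAC
  ext i j
  fin_cases i <;> fin_cases j <;>
    simp only [Matrix.mul_apply, Fin.sum_univ_two, Fin.zero_eta, Fin.mk_one, Fin.isValue]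
  · linear_combination h1
  · linear_combination h2
  · linear_combination -h3
  · linear_combination -h1

/-- The eigenspaces of a non-scalar `2 × 2` matrix are lines, hence invariant under its
commutant. -/
theorem mulVec_eq_smul_of_commute_nonscalar (hk : k = 2) {M N : Matrix (Fin k) (Fin k) ℂ}
    (hM : ¬ ∃ c : ℂ, M = c • 1) (hMN : Commute M N) {v : Fin k → ℂ} {μ : ℂ}
    (hv : star v ⬝ᵥ v = 1) (hMv : M *ᵥ v = μ • v) : N *ᵥ v = (star v ⬝ᵥ N *ᵥ v) • v := by
  subst hk
  have hMw : M *ᵥ (N *ᵥ v) = μ • (N *ᵥ v) := by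
    rw [Matrix.mulVec_mulVec, hMN.eq, ← Matrix.mulVec_mulVec, hMv, Matrix.mulVec_smul]
  generalize N *ᵥ v = w at hMw
  have v0 := congrFun hMv 0
  have v1 := congrFun hMv 1
  have w0 := congrFun hMw 0
  have w1 := congrFun hMw 1
  simp only [Matrix.mulVec, dotProduct, Fin.sum_univ_two, Pi.smul_apply, smul_eq_mul] at v0 v1 w0 w1
  have hD : v 0 * w 1 - v 1 * w 0 = 0 := by
    by_contra hD
    refine hM ⟨μ, ?_⟩
    ext i j
    fin_cases i <;> fin_cases j <;> simp <;> apply mul_left_cancel₀ hD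
    · linear_combination w 1 * v0 - v 1 * w0
    · linear_combination v 0 * w0 - w 0 * v0
    · linear_combination w 1 * v1 - v 1 * w1
    · linear_combination v 0 * w1 - w 0 * v1
  simp only [dotProduct, Fin.sum_univ_two, Pi.star_apply] at hv ⊢
  ext i
  fin_cases i <;> simp only [Pi.smul_apply, smul_eq_mul, Fin.zero_eta, Fin.mk_one, Fin.isValue]
  · linear_combination (-w 0) * hv - star (v 1) * hD
  · linear_combination (-w 1) * hv + star (v 0) * hD

open scoped ComplexOrder in
/-- A complex matrix of positive size has a unit eigenvector. -/
theorem exists_unit_eigenvector (hk : 0 < k) (M : Matrix (Fin k) (Fin k) ℂ) :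
    ∃ (v : Fin k → ℂ) (μ : ℂ), star v ⬝ᵥ v = 1 ∧ M *ᵥ v = μ • v := by
  have : Nonempty (Fin k) := ⟨⟨0, hk⟩⟩
  obtain ⟨μ, hμ⟩ := Module.End.exists_eigenvalue (Matrix.toLin' M)
  obtain ⟨v, hv⟩ := hμ.exists_hasEigenvector
  have hMv : M *ᵥ v = μ • v := by simpa using hv.apply_eq_smul
  have hpos : 0 < star v ⬝ᵥ v := dotProduct_star_self_pos_iff.2 hv.2
  obtain ⟨r, hr, hrv⟩ : ∃ r : ℝ, 0 < r ∧ star v ⬝ᵥ v = r := by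
    obtain ⟨h1, h2⟩ := Complex.lt_def.1 hpos
    exact ⟨_, h1, Complex.ext rfl (by simpa using h2.symm)⟩
  refine ⟨((Real.sqrt r)⁻¹ : ℂ) • v, μ, ?_, ?_⟩
  · have hs : ((Real.sqrt r : ℝ) : ℂ) ≠ 0 := by exact_mod_cast (Real.sqrt_pos.2 hr).ne'
    have hsq : ((Real.sqrt r : ℝ) : ℂ) * (Real.sqrt r : ℝ) = r := by
      exact_mod_cast Real.mul_self_sqrt hr.le
    rw [star_smul, smul_dotProduct, dotProduct_smul, hrv, ← hsq]
    simp
    field_simp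
  · rw [Matrix.mulVec_smul, hMv, smul_comm]

/-- A unit vector of `ℂ²` extends to an orthonormal basis. -/
theorem exists_orthonormal_complement (hk : k = 2) {v : Fin k → ℂ} (hv : star v ⬝ᵥ v = 1) :
    ∃ w : Fin k → ℂ, star w ⬝ᵥ w = 1 ∧ star v ⬝ᵥ w = 0 := by
  subst hk
  refine ⟨![-star (v 1), star (v 0)], ?_, ?_⟩ <;> simp [dotProduct, Fin.sum_univ_two] at hv ⊢
  · linear_combination hv
  · ring

/-- A matrix having `v` as an eigenvector, and whose adjoint does too, commutes with the
projection onto `ℂv`. -/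
theorem commute_vecMulVec_star {N : Matrix (Fin k) (Fin k) ℂ} {v : Fin k → ℂ} {c c' : ℂ}
    (hv : star v ⬝ᵥ v = 1) (h : N *ᵥ v = c • v) (h' : Nᴴ *ᵥ v = c' • v) :
    Commute N (vecMulVec v (star v)) := by
  have hs : star v ᵥ* N = star c' • star v := by
    rw [← star_smul, ← h', Matrix.star_mulVec, Matrix.conjTranspose_conjTranspose]
  have hc : c = star c' := by
    have := Matrix.dotProduct_mulVec (star v) N v
    rw [h, hs] at this
    simpa [hv] using this
  rw [commute_iff_eq, Matrix.mul_vecMulVec, Matrix.vecMulVec_mul, h, hs, ← hc]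
  simp [Matrix.smul_vecMulVec, Matrix.vecMulVec_smul]

end TwoByTwo

section Slices

variable {n : ℕ} {d : Fin n → ℕ}

/-- The operator on particle `q` obtained from `H` by fixing the row and column indices of all
other particles to those of `a` and `b`. -/
def slice (q : Fin n) (H : Matrix (∀ i, Fin (d i)) (∀ i, Fin (d i)) ℂ)
    (a b : ∀ i, Fin (d i)) : Matrix (Fin (d q)) (Fin (d q)) ℂ :=
  Matrix.of fun s t => H (Function.update a q s) (Function.update b q t)

theorem conjTranspose_slice {q : Fin n} {H : Matrix (∀ i, Fin (d i)) (∀ i, Fin (d i)) ℂ}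
    (hH : H.IsHermitian) (a b : ∀ i, Fin (d i)) : (slice q H a b)ᴴ = slice q H b a := by
  ext s t
  exact hH.apply _ _

/-- A sum over configurations whose terms vanish unless the configuration agrees with `w`
away from `q` is a sum over the states of particle `q`. -/
theorem sum_eq_sum_update (q : Fin n) (w : ∀ i, Fin (d i)) (F : (∀ i, Fin (d i)) → ℂ)
    (hF : ∀ z, (∃ i, i ≠ q ∧ z i ≠ w i) → F z = 0) :
    ∑ z, F z = ∑ t, F (Function.update w q t) := by
  symm
  refine Fintype.sum_of_injective (Function.update w q) (Function.update_injective w q) _ _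
    (fun z hz => hF z ?_) fun _ => rfl
  by_contra! h
  exact hz ⟨z q, by
    ext i
    by_cases hi : i = q
    · subst hi; simp
    · simp [hi, h i hi]⟩

theorem commute_projAt_of_slice {q : Fin n} {H : Matrix (∀ i, Fin (d i)) (∀ i, Fin (d i)) ℂ}
    {v : Fin (d q) → ℂ} (h : ∀ a b, Commute (slice q H a b) (vecMulVec v (star v))) :
    Commute H (projAt q v) := by
  have proj_update (x : ∀ i, Fin (d i)) (s t) :
      projAt q v (Function.update x q s) (Function.update x q t) = v s * star (v t) := by
    simp [projAt]
  have proj_zero (x y : ∀ i, Fin (d i)) (hxy : ∃ i, i ≠ q ∧ x i ≠ y i) :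
      projAt q v x y = 0 := by
    obtain ⟨i, hi, hne⟩ := hxy
    refine if_neg fun he => hne ?_
    simpa [hi] using congrFun he i
  ext x y
  have key := congrFun (congrFun (h x y).eq (x q)) (y q)
  simp only [Matrix.mul_apply, vecMulVec_apply, Pi.star_apply] at key
  rw [Matrix.mul_apply, Matrix.mul_apply,
    sum_eq_sum_update q y _ fun z hz => by rw [proj_zero z y hz, mul_zero],
    sum_eq_sum_update q x _ fun z hz => by
      obtain ⟨i, hi, hne⟩ := hz
      rw [proj_zero x z ⟨i, hi, hne.symm⟩, zero_mul]]
  convert key using 2 with t _ t _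
  · have := proj_update y t (y q)
    rw [Function.update_eq_self] at this
    simp [this, slice]
  · have := proj_update x (x q) t
    rw [Function.update_eq_self] at this
    simp [this, slice]

theorem ActsTriviallyAt.apply_eq_zero {H : Matrix (∀ i, Fin (d i)) (∀ i, Fin (d i)) ℂ}
    {i : Fin n} (h : ActsTriviallyAt H i) {x y : ∀ i, Fin (d i)} (hxy : x i ≠ y i) :
    H x y = 0 := by
  obtain ⟨N, hN⟩ := h
  simp [hN, hxy]

theorem ActsTriviallyAt.apply_update {H : Matrix (∀ i, Fin (d i)) (∀ i, Fin (d i)) ℂ}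
    {i : Fin n} (h : ActsTriviallyAt H i) {x y : ∀ i, Fin (d i)} (hxy : x i = y i)
    (s : Fin (d i)) : H (Function.update x i s) (Function.update y i s) = H x y := by
  obtain ⟨N, hN⟩ := h
  have upd (z : ∀ i, Fin (d i)) : (fun j : {j : Fin n // j ≠ i} => Function.update z i s j.1) =
      fun j : {j : Fin n // j ≠ i} => z j.1 := by
    funext j
    rw [Function.update_of_ne j.2]
  simp [hN, hxy, upd]

theorem ActsTriviallyAt.slice_eq_smul {q : Fin n}
    {H : Matrix (∀ i, Fin (d i)) (∀ i, Fin (d i)) ℂ}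
    (h : ActsTriviallyAt H q) (a b : ∀ i, Fin (d i)) : ∃ c : ℂ, slice q H a b = c • 1 := by
  refine ⟨H a (Function.update b q (a q)), ?_⟩
  ext s t
  by_cases hst : s = t
  · subst hst
    have := h.apply_update (x := a) (y := Function.update b q (a q)) (by simp) s
    simpa [slice] using this
  · simpa [slice, hst] using
      h.apply_eq_zero (x := Function.update a q s) (y := Function.update b q t) (by simpa)

/-- An operator acting nontrivially on `q` has a non-scalar slice. -/
theorem exists_nonscalar_slice {q : Fin n} (hq : 0 < d q)
    {H : Matrix (∀ i, Fin (d i)) (∀ i, Fin (d i)) ℂ} (h : q ∈ supp H) :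
    ∃ a b, ¬ ∃ c : ℂ, slice q H a b = c • 1 := by
  by_contra! hall
  apply h
  let ext (z : ∀ j : {j : Fin n // j ≠ q}, Fin (d j.1)) : ∀ i, Fin (d i) := fun i =>
    if hi : i = q then hi ▸ ⟨0, hq⟩ else z ⟨i, hi⟩
  have update_ext (x : ∀ i, Fin (d i)) :
      Function.update (ext fun j => x j.1) q (x q) = x := by
    ext i
    by_cases hi : i = q
    · subst hi; simp
    · simp [hi, ext]
  refine ⟨Matrix.of fun a b => slice q H (ext a) (ext b) ⟨0, hq⟩ ⟨0, hq⟩, fun x y => ?_⟩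
  obtain ⟨c, hc⟩ := hall (ext fun j => x j.1) (ext fun j => y j.1)
  have hxy : H x y = slice q H (ext fun j => x j.1) (ext fun j => y j.1) (x q) (y q) := by
    simp [slice, update_ext]
  rw [hxy, Matrix.of_apply, hc]
  simp [Matrix.one_apply]

/-- An operator acting trivially on all of `B` has entries that only depend on the indices
outside `B`, as long as the two indices agree on `B`. -/
theorem apply_eq_of_actsTriviallyAt {H : Matrix (∀ i, Fin (d i)) (∀ i, Fin (d i)) ℂ}
    (B : Finset (Fin n)) (h : ∀ i ∈ B, ActsTriviallyAt H i) {x y x' y' : ∀ i, Fin (d i)}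
    (hx : ∀ i ∉ B, x i = x' i) (hy : ∀ i ∉ B, y i = y' i)
    (hxy : ∀ i ∈ B, x i = y i) (hxy' : ∀ i ∈ B, x' i = y' i) : H x y = H x' y' := by
  induction B using Finset.induction_on generalizing x y with
  | empty =>
    rw [show x = x' from funext fun i => hx i (by simp),
      show y = y' from funext fun i => hy i (by simp)]
  | insert j B hj ih =>
    rw [← (h j (by simp)).apply_update (hxy j (by simp)) (x' j)]
    refine ih (fun i hi => h i (by simp [hi])) (fun i hi => ?_) (fun i hi => ?_)
      (fun i hi => ?_) fun i hi => hxy' i (by simp [hi])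
    · by_cases hij : i = j
      · subst hij; simp
      · simpa [hij] using hx i (by simp [hij, hi])
    · by_cases hij : i = j
      · subst hij; simpa using hxy' i (by simp)
      · simpa [hij] using hy i (by simp [hij, hi])
    · have hij : i ≠ j := fun e => hj (e ▸ hi)
      simpa [hij] using hxy i (by simp [hi])

theorem slice_eq_zero {q i : Fin n} {H : Matrix (∀ i, Fin (d i)) (∀ i, Fin (d i)) ℂ}
    (h : ActsTriviallyAt H i) (hi : i ≠ q) {a b : ∀ i, Fin (d i)} (hab : a i ≠ b i) :
    slice q H a b = 0 := by
  ext s t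
  exact h.apply_eq_zero (by simpa [hi] using hab)

/-- The slices at `q` of two commuting operators whose supports meet only in `q` commute. -/
theorem Butterfly.commute_slice {q : Fin n}
    {H₁ H₂ : Matrix (∀ i, Fin (d i)) (∀ i, Fin (d i)) ℂ} (h : Butterfly q H₁ H₂)
    (hcomm : Commute H₁ H₂) (a b c e : ∀ i, Fin (d i)) :
    Commute (slice q H₁ a b) (slice q H₂ c e) := by
  classical
  let A : Finset (Fin n) := {i | i ≠ q ∧ i ∈ supp H₁}
  let B : Finset (Fin n) := {i | i ≠ q ∧ i ∉ supp H₁}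
  have hA : ∀ i ∈ A, ActsTriviallyAt H₂ i := by
    intro i hi
    simp only [A, Finset.mem_filter, Finset.mem_univ, true_and] at hi
    by_contra h2
    have : i ∈ supp H₁ ∩ supp H₂ := ⟨hi.2, h2⟩
    rw [h] at this
    exact hi.1 this
  have hB : ∀ i ∈ B, ActsTriviallyAt H₁ i := by
    intro i hi
    simp only [B, Finset.mem_filter, Finset.mem_univ, true_and] at hi
    exact not_not.1 hi.2
  have hAq {i} (hi : i ∈ A) : i ≠ q := (Finset.mem_filter.1 hi).2.1
  have hBq {i} (hi : i ∈ B) : i ≠ q := (Finset.mem_filter.1 hi).2.1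
  have hAB {i} (hi : i ≠ q) : i ∉ A ↔ i ∈ B := by simp [A, B, hi]
  by_cases hab : ∃ i ∈ B, a i ≠ b i
  · obtain ⟨i, hi, hne⟩ := hab
    rw [slice_eq_zero (hB i hi) (hBq hi) hne]
    exact Commute.zero_left _
  by_cases hce : ∃ i ∈ A, c i ≠ e i
  · obtain ⟨i, hi, hne⟩ := hce
    rw [slice_eq_zero (hA i hi) (hAq hi) hne]
    exact Commute.zero_right _
  push Not at hab hce
  let mix (f g : ∀ i, Fin (d i)) : ∀ i, Fin (d i) := fun i => if i ∈ A then f i else g i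
  have mix_A (f g) {i} (hi : i ∈ A) : mix f g i = f i := if_pos hi
  have mix_B (f g) {i} (hi : i ∈ B) : mix f g i = g i := if_neg ((hAB (hBq hi)).2 hi)
  have off_B {f g} {s : Fin (d q)} (i) (hi : i ∉ B) :
      Function.update (mix f g) q s i = Function.update f q s i := by
    by_cases hiq : i = q
    · subst hiq; simp
    · simpa [hiq] using mix_A f g (not_not.1 fun h' => hi ((hAB hiq).1 h'))
  have off_A {f g} {s : Fin (d q)} (i) (hi : i ∉ A) :
      Function.update (mix f g) q s i = Function.update g q s i := by
    by_cases hiq : i = q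
    · subst hiq; simp
    · simpa [hiq] using mix_B f g ((hAB hiq).1 hi)
  have entry₁ (g s t) : H₁ (Function.update (mix a g) q s) (Function.update (mix b g) q t) =
      slice q H₁ a b s t :=
    apply_eq_of_actsTriviallyAt B hB off_B off_B
      (fun i hi => by simp [hBq hi, mix_B _ _ hi])
      (fun i hi => by simpa [hBq hi] using hab i hi)
  have entry₂ (f s t) : H₂ (Function.update (mix f c) q s) (Function.update (mix f e) q t) =
      slice q H₂ c e s t :=
    apply_eq_of_actsTriviallyAt A hA off_A off_A
      (fun i hi => by simp [hAq hi, mix_A _ _ hi])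
      (fun i hi => by simpa [hAq hi] using hce i hi)
  have zero₁ {x y : ∀ i, Fin (d i)} {i} (hi : i ∈ B) (hxy : x i ≠ y i) : H₁ x y = 0 :=
    (hB i hi).apply_eq_zero hxy
  have zero₂ {x y : ∀ i, Fin (d i)} {i} (hi : i ∈ A) (hxy : x i ≠ y i) : H₂ x y = 0 :=
    (hA i hi).apply_eq_zero hxy
  ext s u
  have key := congrFun (congrFun hcomm.eq (Function.update (mix a c) q s))
    (Function.update (mix b e) q u)
  rw [Matrix.mul_apply, Matrix.mul_apply, sum_eq_sum_update q (mix b c),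
    sum_eq_sum_update q (mix a e)] at key
  · simpa only [entry₁, entry₂, ← Matrix.mul_apply] using key
  · rintro z ⟨i, hiq, hne⟩
    by_cases hi : i ∈ A
    · rw [zero₂ hi, zero_mul]
      simpa [hiq, mix_A _ _ hi] using hne.symm
    · replace hi := (hAB hiq).1 hi
      rw [zero₁ hi, mul_zero]
      simpa [hiq, mix_B _ _ hi] using hne
  · rintro z ⟨i, hiq, hne⟩
    by_cases hi : i ∈ A
    · rw [zero₂ hi, mul_zero]
      simpa [hiq, mix_A _ _ hi] using hne
    · replace hi := (hAB hiq).1 hi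
      rw [zero₁ hi, zero_mul]
      simpa [hiq, mix_B _ _ hi] using hne.symm

end Slices

/-- Theorem 4.1/4.8.  Let `S` be a finite set of pairwise commuting
self-adjoint operators on `H_1 ⊗ ⋯ ⊗ H_n` and let `q` be a particle with `dim H_q = 2`.
If at least two elements of `S` act nontrivially on `q`, and every two elements of `S`
acting nontrivially on `q` are butterfly-connected with respect to `q`, then `q` is
separable for `S`. -/
theorem butterfly_connected_implies_separable
    {n : ℕ} {d : Fin n → ℕ} (q : Fin n) (hq : d q = 2)
    (S : Finset (Matrix (∀ i, Fin (d i)) (∀ i, Fin (d i)) ℂ))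
    (hsa : ∀ H ∈ S, H.IsHermitian)
    (hcomm : ∀ H ∈ S, ∀ H' ∈ S, Commute H H')
    (htwo : ∃ H₁ ∈ S, ∃ H₂ ∈ S, H₁ ≠ H₂ ∧ q ∈ supp H₁ ∧ q ∈ supp H₂)
    (hconn : ∀ H₁ ∈ S, ∀ H₂ ∈ S, q ∈ supp H₁ → q ∈ supp H₂ →
      ButterflyConnected S q H₁ H₂) :
    SeparableAt S q := by
  have hpos : 0 < d q := by omega
  obtain ⟨H₁, hH₁, H₂, hH₂, hne, hq₁, hq₂⟩ := htwo
  obtain ⟨a, b, hM⟩ := exists_nonscalar_slice hpos hq₁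
  have step {K K'} (hK : K ∈ S) (hK' : K' ∈ S) (hKq : q ∈ supp K) (hKK' : Butterfly q K K')
      (h : ∀ x y, Commute (slice q H₁ a b) (slice q K x y)) :
      ∀ x y, Commute (slice q H₁ a b) (slice q K' x y) := by
    obtain ⟨x', y', hN⟩ := exists_nonscalar_slice hpos hKq
    exact fun x y => commute_of_commute_nonscalar hq hN (h x' y')
      (hKK'.commute_slice (hcomm K hK K' hK') x' y' x y)
  have base : ∀ x y, Commute (slice q H₁ a b) (slice q H₁ x y) := by
    obtain ⟨m, K, h0, hm, hK, hbf⟩ := hconn H₁ hH₁ H₂ hH₂ hq₁ hq₂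
    obtain _ | m := m
    · exact absurd (h0.symm.trans hm) hne
    have hbf' : Butterfly q H₁ (K 1) := by simpa [h0] using hbf 0
    obtain ⟨x', y', hN⟩ := exists_nonscalar_slice hpos (hK 1).2
    have hc := hcomm H₁ hH₁ _ (hK 1).1
    exact fun x y => commute_of_commute_nonscalar hq hN (hbf'.commute_slice hc a b x' y')
      (hbf'.commute_slice hc x y x' y').symm
  have all : ∀ H ∈ S, ∀ x y, Commute (slice q H₁ a b) (slice q H x y) := by
    intro H hH
    by_cases hHq : q ∈ supp H
    · obtain ⟨m, K, h0, rfl, hK, hbf⟩ := hconn H₁ hH₁ H hH hq₁ hHq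
      suffices ∀ i, ∀ x y, Commute (slice q H₁ a b) (slice q (K i) x y) from this _
      intro i
      induction i using Fin.induction with
      | zero => rwa [h0]
      | succ i ih => exact step (hK _).1 (hK _).1 (hK _).2 (hbf i) ih
    · intro x y
      obtain ⟨c, hc⟩ := (not_not.1 hHq : ActsTriviallyAt H q).slice_eq_smul x y
      rw [hc]
      exact (Commute.one_right _).smul_right c
  obtain ⟨v, μ, hv, hMv⟩ := exists_unit_eigenvector hpos (slice q H₁ a b)
  obtain ⟨w, hw, hvw⟩ := exists_orthonormal_complement hq hv
  refine ⟨v, w, hv, hw, hvw, fun H hH => commute_projAt_of_slice fun x y => ?_⟩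
  have eig (x y) := mulVec_eq_smul_of_commute_nonscalar hq hM (all H hH x y) hv hMv
  exact commute_vecMulVec_star hv (eig x y)
    ((congrArg (· *ᵥ v) (conjTranspose_slice (hsa H hH) x y)).trans (eig y x))
end

section
/- Let H_q, E₁, E₂ be finite-dimensional complex Hilbert spaces with dim H_q ≤ 3. Let H₁ = H̃₁ ⊗ I_{E₂} for a self-adjoint operator H̃₁ on H_q ⊗ E₁, and let H₂ be the operator on H_q ⊗ E₁ ⊗ E₂ corresponding, under the canonical permutation of tensor factors, to H̃₂ ⊗ I_{E₁} for a self-adjoint operator H̃₂ on H_q ⊗ E₂. Assume H₁ and H₂ commute and that each acts nontrivially on H_q. Then: (i) H₁ has at least one critical subspace on H_q and so does H₂; and (ii) every critical subspace of H₁ on H_q is preserved by H₂ (i.e., H₂ maps S ⊗ E₁ ⊗ E₂ into itself for every such critical subspace S), and symmetrically every critical subspace of H₂ on H_q is preserved by H₁. (Fact 5.6.) -/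
open Matrix Kronecker

/-- The `(k,l)` slice of an operator `H` on `V ⊗ W`: the operator `A` on `V` with
`A i j = H (i,k) (j,l)`.  Expanding `H` in the (linearly independent) standard matrix basis
of `End(W)`, these slices are precisely the `V`-side coefficients. -/
def sliceMat {dV : ℕ} {W : Type} (H : Matrix (Fin dV × W) (Fin dV × W) ℂ) (k l : W) :
    Matrix (Fin dV) (Fin dV) ℂ :=
  Matrix.of fun i j => H (i, k) (j, l)

/-- The algebra induced by `H` on `V`: the unital subalgebra of `End(V)` generated by the
coefficients of (any, equivalently this canonical) decomposition `H = Σ A_α ⊗ B_α` with the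
`B_α` linearly independent. -/
def inducedAlg {dV : ℕ} {W : Type} (H : Matrix (Fin dV × W) (Fin dV × W) ℂ) :
    Subalgebra ℂ (Matrix (Fin dV) (Fin dV) ℂ) :=
  Algebra.adjoin ℂ {A | ∃ k l : W, A = sliceMat H k l}

/-- The orthogonal projection onto the line `ℂv`, for a unit vector `v`. -/
def projMat {m : ℕ} (v : Fin m → ℂ) : Matrix (Fin m) (Fin m) ℂ :=
  vecMulVec v (star v)

/-- The one-dimensional subspace `ℂv` (given by a unit vector `v`) is a critical subspace of
`H` on `V`: the orthogonal projection onto it lies in the center of the algebra induced by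
`H` on `V`. -/
def IsCriticalLine {dV : ℕ} {W : Type} (H : Matrix (Fin dV × W) (Fin dV × W) ℂ)
    (v : Fin dV → ℂ) : Prop :=
  star v ⬝ᵥ v = 1 ∧ projMat v ∈ inducedAlg H ∧
    ∀ X ∈ inducedAlg H, Commute (projMat v) X

/-- `H` preserves the subspace `ℂv ⊗ W` of `V ⊗ W`. -/
def PreservesLine {dV : ℕ} {W : Type} [Fintype W] [DecidableEq W]
    (H : Matrix (Fin dV × W) (Fin dV × W) ℂ) (v : Fin dV → ℂ) : Prop :=
  ((projMat v) ⊗ₖ (1 : Matrix W W ℂ)) * (H * ((projMat v) ⊗ₖ (1 : Matrix W W ℂ))) =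
    H * ((projMat v) ⊗ₖ (1 : Matrix W W ℂ))

/-- The slices of a Hermitian operator are exchanged by the adjoint. -/
lemma conjTranspose_sliceMat {d : ℕ} {W : Type} {H : Matrix (Fin d × W) (Fin d × W) ℂ}
    (hH : H.IsHermitian) (k l : W) : (sliceMat H k l)ᴴ = sliceMat H l k := by
  ext i j
  exact hH.apply (i, l) (j, k)

/-- The algebra induced by a Hermitian operator is closed under the adjoint. -/
lemma conjTranspose_mem_inducedAlg {d : ℕ} {W : Type} {H : Matrix (Fin d × W) (Fin d × W) ℂ}
    (hH : H.IsHermitian) {A : Matrix (Fin d) (Fin d) ℂ} (hA : A ∈ inducedAlg H) :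
    Aᴴ ∈ inducedAlg H := by
  induction hA using Algebra.adjoin_induction with
  | mem x hx =>
    obtain ⟨k, l, rfl⟩ := hx
    rw [conjTranspose_sliceMat hH]
    exact Algebra.subset_adjoin ⟨l, k, rfl⟩
  | algebraMap r =>
    rw [Algebra.algebraMap_eq_smul_one, conjTranspose_smul, conjTranspose_one]
    exact Subalgebra.smul_mem _ (one_mem _) _
  | add x y _ _ hx hy =>
    rw [conjTranspose_add]
    exact add_mem hx hy
  | mul x y _ _ hx hy =>
    rw [conjTranspose_mul]
    exact mul_mem hy hx

/-- Operators whose slices commute induce commuting algebras. -/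
lemma commute_of_mem_inducedAlg {d : ℕ} {W W' : Type}
    {H : Matrix (Fin d × W) (Fin d × W) ℂ} {K : Matrix (Fin d × W') (Fin d × W') ℂ}
    (hHK : ∀ k l m n, Commute (sliceMat H k l) (sliceMat K m n))
    {A B : Matrix (Fin d) (Fin d) ℂ} (hA : A ∈ inducedAlg H) (hB : B ∈ inducedAlg K) :
    Commute A B := by
  refine Algebra.commute_of_mem_adjoin_of_forall_mem_commute hB ?_
  rintro _ ⟨m, n, rfl⟩
  refine (Algebra.commute_of_mem_adjoin_of_forall_mem_commute hA ?_).symm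
  rintro _ ⟨k, l, rfl⟩
  exact (hHK k l m n).symm

/-- The algebra induced by a Hermitian operator acting nontrivially contains a nonscalar
Hermitian matrix. -/
lemma exists_isHermitian_mem_inducedAlg {d : ℕ} {W : Type}
    {H : Matrix (Fin d × W) (Fin d × W) ℂ} (hH : H.IsHermitian) (hnt : ¬ ActsTrivFst H) :
    ∃ Y ∈ inducedAlg H, Y.IsHermitian ∧ ∀ c : ℂ, Y ≠ c • 1 := by
  by_contra! hcon
  refine hnt ?_
  have hscalar : ∀ k l, ∃ c : ℂ, sliceMat H k l = c • 1 := by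
    intro k l
    have hA : sliceMat H k l ∈ inducedAlg H := Algebra.subset_adjoin ⟨k, l, rfl⟩
    have hA' := conjTranspose_mem_inducedAlg hH hA
    set A := sliceMat H k l
    obtain ⟨a, ha⟩ := hcon (A + Aᴴ) (add_mem hA hA') (by simp [IsHermitian, add_comm])
    obtain ⟨b, hb⟩ := hcon (Complex.I • (A - Aᴴ))
      (Subalgebra.smul_mem _ (sub_mem hA hA') _) (by
        simp [IsHermitian, conjTranspose_smul, ← smul_neg])
    refine ⟨(a - Complex.I * b) / 2, ?_⟩
    have hA2 : (2 : ℂ) • A = (A + Aᴴ) - Complex.I • (Complex.I • (A - Aᴴ)) := by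
      rw [smul_smul, Complex.I_mul_I]
      module
    rw [ha, hb, smul_smul, ← sub_smul] at hA2
    rw [div_eq_inv_mul, mul_smul, ← hA2, smul_smul]
    norm_num
  choose c hc using hscalar
  refine ⟨Matrix.of c, fun p q => ?_⟩
  have h := congrFun (congrFun (hc p.2 q.2) p.1) q.1
  simpa [sliceMat, one_apply, mul_comm] using h

/-- A nonconstant family of at most three elements has an element attained exactly once. -/
lemma exists_forall_ne_of_card_le_three {d : ℕ} (hd : d ≤ 3) {α : Type*} (f : Fin d → α)
    (hf : ∃ i j, f i ≠ f j) : ∃ i, ∀ j, j ≠ i → f j ≠ f i := by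
  obtain ⟨a, b, hab⟩ := hf
  by_contra! hcon
  obtain ⟨a', ha', hfa⟩ := hcon a
  obtain ⟨b', hb', hfb⟩ := hcon b
  have hab' : a ≠ b := fun h => hab (h ▸ rfl)
  have h1 : a' ≠ b := fun h => hab (by rw [← hfa, h])
  have h2 : b' ≠ a := fun h => hab (by rw [← hfb, h])
  have h3 : a' ≠ b' := fun h => hab (by rw [← hfa, ← hfb, h])
  omega

/-- A polynomial in a matrix acts on an eigenvector through the eigenvalue. -/
lemma aeval_mulVec_eigenvector {d : ℕ} {Y : Matrix (Fin d) (Fin d) ℂ} {v : Fin d → ℂ} {μ : ℂ}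
    (hv : Y *ᵥ v = μ • v) (p : Polynomial ℂ) :
    Polynomial.aeval Y p *ᵥ v = p.eval μ • v := by
  induction p using Polynomial.induction_on' with
  | add p q hp hq => simp [add_mulVec, hp, hq, add_smul]
  | monomial n a =>
    have hpow : Y ^ n *ᵥ v = μ ^ n • v := by
      induction n with
      | zero => simp
      | succ n ih => rw [pow_succ, ← mulVec_mulVec, hv, mulVec_smul, ih, smul_smul, pow_succ']
    rw [Polynomial.aeval_monomial, Algebra.algebraMap_eq_smul_one, smul_mul_assoc, one_mul,
      smul_mulVec, hpow, smul_smul, Polynomial.eval_monomial]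

/-- The spectral projection of a Hermitian matrix onto a simple eigenvector is a polynomial in
the matrix. -/
lemma projMat_eigenvector_mem {d : ℕ} {Y : Matrix (Fin d) (Fin d) ℂ} (hY : Y.IsHermitian)
    {S : Subalgebra ℂ (Matrix (Fin d) (Fin d) ℂ)} (hYS : Y ∈ S) (i : Fin d)
    (hi : ∀ j, j ≠ i → hY.eigenvalues j ≠ hY.eigenvalues i) :
    projMat (hY.eigenvectorBasis i).ofLp ∈ S := by
  set μ : Fin d → ℂ := fun j => (hY.eigenvalues j : ℂ)
  set p : Polynomial ℂ := ∏ j ∈ Finset.univ.erase i, (Polynomial.X - Polynomial.C (μ j))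
  have hpi : p.eval (μ i) ≠ 0 := by
    rw [Polynomial.eval_prod, Finset.prod_ne_zero_iff]
    intro j hj
    have hji := hi j (Finset.ne_of_mem_erase hj)
    simp only [Polynomial.eval_sub, Polynomial.eval_X, Polynomial.eval_C, μ]
    exact sub_ne_zero.mpr fun h => hji (Complex.ofReal_injective h.symm)
  have hpj : ∀ j, j ≠ i → p.eval (μ j) = 0 := by
    intro j hj
    rw [Polynomial.eval_prod]
    exact Finset.prod_eq_zero (Finset.mem_erase.mpr ⟨hj, Finset.mem_univ j⟩) (by simp)
  have heig : ∀ j, Y *ᵥ (hY.eigenvectorBasis j).ofLp = μ j • (hY.eigenvectorBasis j).ofLp := by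
    intro j
    rw [hY.mulVec_eigenvectorBasis j]
    rfl
  have hproj : projMat (hY.eigenvectorBasis i).ofLp = (p.eval (μ i))⁻¹ • Polynomial.aeval Y p := by
    have hlin : toLin' (projMat (hY.eigenvectorBasis i).ofLp) =
        toLin' ((p.eval (μ i))⁻¹ • Polynomial.aeval Y p) := by
      refine (hY.eigenvectorBasis.toBasis.map (WithLp.linearEquiv 2 ℂ (Fin d → ℂ))).ext fun j => ?_
      have hinner : star (hY.eigenvectorBasis i).ofLp ⬝ᵥ (hY.eigenvectorBasis j).ofLp =
          if i = j then 1 else 0 := by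
        have h := orthonormal_iff_ite.mp hY.eigenvectorBasis.orthonormal i j
        rw [EuclideanSpace.inner_eq_star_dotProduct, dotProduct_comm] at h
        exact h
      rw [Module.Basis.map_apply, OrthonormalBasis.coe_toBasis, toLin'_apply, toLin'_apply]
      change _ *ᵥ (hY.eigenvectorBasis j).ofLp = _ *ᵥ (hY.eigenvectorBasis j).ofLp
      rw [smul_mulVec, aeval_mulVec_eigenvector (heig j), projMat, vecMulVec_mulVec, hinner]
      by_cases hij : i = j
      · subst hij
        simp [smul_smul, hpi]
      · simp [hij, hpj j (Ne.symm hij)]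
    exact toLin'.injective hlin
  rw [hproj]
  exact Subalgebra.smul_mem _
    (Algebra.adjoin_le (by simpa using hYS) (Polynomial.aeval_mem_adjoin_singleton ℂ Y)) _

/-- In dimension at most three, the algebra induced by a Hermitian operator acting nontrivially
contains a rank-one orthogonal projection. -/
lemma exists_projMat_mem_inducedAlg {d : ℕ} (hd : d ≤ 3) {W : Type}
    {H : Matrix (Fin d × W) (Fin d × W) ℂ} (hH : H.IsHermitian) (hnt : ¬ ActsTrivFst H) :
    ∃ v : Fin d → ℂ, star v ⬝ᵥ v = 1 ∧ projMat v ∈ inducedAlg H := by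
  obtain ⟨Y, hYmem, hY, hYc⟩ := exists_isHermitian_mem_inducedAlg hH hnt
  have hne : ∃ i j, hY.eigenvalues i ≠ hY.eigenvalues j := by
    by_contra! hcon
    obtain ⟨c, hc⟩ : ∃ c : ℝ, ∀ i, hY.eigenvalues i = c := by
      rcases isEmpty_or_nonempty (Fin d) with hemp | ⟨⟨i⟩⟩
      · exact ⟨0, fun i => hemp.elim i⟩
      · exact ⟨_, fun j => hcon j i⟩
    refine hYc c ?_
    have hdiag : diagonal (RCLike.ofReal ∘ hY.eigenvalues) =
        (c : ℂ) • (1 : Matrix (Fin d) (Fin d) ℂ) := by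
      rw [smul_one_eq_diagonal]
      congr 1
      funext i
      simp [hc i]
    rw [hY.spectral_theorem, hdiag, map_smul, map_one]
  obtain ⟨i, hi⟩ := exists_forall_ne_of_card_le_three hd _ hne
  refine ⟨_, ?_, projMat_eigenvector_mem hY hYmem i hi⟩
  have h := orthonormal_iff_ite.mp hY.eigenvectorBasis.orthonormal i i
  rw [EuclideanSpace.inner_eq_star_dotProduct, dotProduct_comm] at h
  simpa using h

lemma projMat_mul_projMat {d : ℕ} (v w : Fin d → ℂ) :
    projMat v * projMat w = (star v ⬝ᵥ w) • vecMulVec v (star w) := by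
  rw [projMat, projMat, vecMulVec_mul_vecMulVec, vecMulVec_smul]

lemma conjTranspose_projMat {d : ℕ} (v : Fin d → ℂ) : (projMat v)ᴴ = projMat v := by
  rw [projMat, conjTranspose_vecMulVec, star_star]

lemma projMat_mul_self {d : ℕ} {v : Fin d → ℂ} (hv : star v ⬝ᵥ v = 1) :
    projMat v * projMat v = projMat v := by
  rw [projMat_mul_projMat, hv, one_smul, projMat]

lemma trace_projMat {d : ℕ} {v : Fin d → ℂ} (hv : star v ⬝ᵥ v = 1) :
    (projMat v).trace = 1 := by
  rw [projMat, trace_vecMulVec, dotProduct_comm, hv]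

/-- Commuting rank-one orthogonal projections are equal or mutually orthogonal. -/
lemma projMat_eq_or_dotProduct_eq_zero {d : ℕ} {v w : Fin d → ℂ} (hv : star v ⬝ᵥ v = 1)
    (hw : star w ⬝ᵥ w = 1) (hvw : Commute (projMat v) (projMat w)) :
    projMat v = projMat w ∨ star v ⬝ᵥ w = 0 := by
  by_cases hc : star v ⬝ᵥ w = 0
  · exact Or.inr hc
  have hc' : star w ⬝ᵥ v ≠ 0 := by
    rwa [star_dotProduct, Ne, star_eq_zero]
  have h1 : projMat v * projMat w =
      ((star v ⬝ᵥ w) * (star w ⬝ᵥ v)) • projMat v := by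
    calc projMat v * projMat w = projMat v * projMat w * projMat v := by
          rw [mul_assoc, ← hvw.eq, ← mul_assoc, projMat_mul_self hv]
      _ = _ := by
          rw [projMat_mul_projMat, projMat, smul_mul_assoc, vecMulVec_mul_vecMulVec,
            vecMulVec_smul, smul_smul]
  have h2 : projMat v * projMat w =
      ((star v ⬝ᵥ w) * (star w ⬝ᵥ v)) • projMat w := by
    calc projMat v * projMat w = projMat w * projMat v * projMat w := by
          rw [← hvw.eq, mul_assoc, projMat_mul_self hw]
      _ = _ := by
          rw [projMat_mul_projMat, projMat, smul_mul_assoc, vecMulVec_mul_vecMulVec,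
            vecMulVec_smul, smul_smul, mul_comm]
  exact Or.inl (smul_right_injective _ (mul_ne_zero hc hc') (h1.symm.trans h2))

open scoped ComplexOrder in
/-- In dimension at most three, three mutually orthogonal rank-one projections sum to the
identity. -/
lemma one_sub_projections_eq_zero {d : ℕ} (hd : d ≤ 3) {P Q N : Matrix (Fin d) (Fin d) ℂ}
    (hP : P * P = P) (hQ : Q * Q = Q) (hN : N * N = N)
    (hPh : Pᴴ = P) (hQh : Qᴴ = Q) (hNh : Nᴴ = N)
    (hPQ : P * Q = 0) (hPN : P * N = 0) (hQN : Q * N = 0)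
    (htP : P.trace = 1) (htQ : Q.trace = 1) (htN : N.trace = 1) : 1 - P - Q - N = 0 := by
  have hQP : Q * P = 0 := by simpa [hPh, hQh] using congrArg conjTranspose hPQ
  have hNP : N * P = 0 := by simpa [hPh, hNh] using congrArg conjTranspose hPN
  have hNQ : N * Q = 0 := by simpa [hQh, hNh] using congrArg conjTranspose hQN
  set T := 1 - P - Q - N with hT
  have hTh : Tᴴ = T := by simp [hT, hPh, hQh, hNh]
  have hTT : Tᴴ * T = T := by
    rw [hTh, hT]
    simp only [mul_sub, sub_mul, mul_one, one_mul, hP, hQ, hN, hPQ, hPN, hQN, hQP, hNP, hNQ]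
    abel
  have htr : T.trace = (((d : ℝ) - 3 : ℝ) : ℂ) := by
    simp only [hT, trace_sub, trace_one, htP, htQ, htN, Fintype.card_fin]
    push_cast
    ring
  have hnonneg : 0 ≤ T.trace := by
    rw [← hTT]
    exact (posSemidef_conjTranspose_mul_self T).trace_nonneg
  rw [← trace_conjTranspose_mul_self_eq_zero_iff, hTT]
  refine le_antisymm ?_ hnonneg
  rw [htr]
  have hdreal : (d : ℝ) ≤ 3 := by exact_mod_cast hd
  exact_mod_cast sub_nonpos.mpr hdreal

open scoped ComplexOrder in
/-- In dimension at most three, a Hermitian operator whose induced algebra contains a rank-one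
projection and commutes with a rank-one projection has a critical subspace. -/
lemma exists_isCriticalLine_of_projMat {d : ℕ} (hd : d ≤ 3) {W : Type}
    {H : Matrix (Fin d × W) (Fin d × W) ℂ} (hH : H.IsHermitian) {v w : Fin d → ℂ}
    (hv : star v ⬝ᵥ v = 1) (hvcomm : ∀ X ∈ inducedAlg H, Commute (projMat v) X)
    (hw : star w ⬝ᵥ w = 1) (hwmem : projMat w ∈ inducedAlg H) :
    ∃ u, IsCriticalLine H u := by
  rcases projMat_eq_or_dotProduct_eq_zero hv hw (hvcomm _ hwmem) with heq | hvw
  · exact ⟨v, hv, heq ▸ hwmem, hvcomm⟩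
  have hQh := conjTranspose_projMat w
  have hQQ := projMat_mul_self hw
  by_cases hoff : ∀ A ∈ inducedAlg H, (1 - projMat w) * A * projMat w = 0
  · refine ⟨w, hw, hwmem, fun X hX => ?_⟩
    have hright : X * projMat w = projMat w * X * projMat w := by
      simpa [sub_mul, sub_eq_zero] using hoff X hX
    have hleft : projMat w * X = projMat w * X * projMat w := by
      have h := congrArg conjTranspose (hoff Xᴴ (conjTranspose_mem_inducedAlg hH hX))
      simpa [hQh, mul_sub, sub_eq_zero, ← mul_assoc] using h
    exact hleft.trans hright.symm
  push Not at hoff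
  obtain ⟨A, hA, hAne⟩ := hoff
  set G := (1 - projMat w) * A with hG
  have hGmem : G ∈ inducedAlg H := mul_mem (sub_mem (one_mem _) hwmem) hA
  set x := G *ᵥ w with hx
  have hPx : projMat v *ᵥ x = 0 := by
    rw [hx, mulVec_mulVec, (hvcomm G hGmem).eq, ← mulVec_mulVec, projMat, vecMulVec_mulVec, hvw]
    simp
  have hQx : projMat w *ᵥ x = 0 := by
    rw [hx, hG, mulVec_mulVec, ← mul_assoc, mul_sub, mul_one, hQQ, sub_self, zero_mul, zero_mulVec]
  have hxx : projMat x = G * projMat w * Gᴴ := by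
    rw [projMat, projMat, mul_vecMulVec, vecMulVec_mul, hx, star_mulVec]
  have hx0 : star x ⬝ᵥ x ≠ 0 := by
    intro h
    refine hAne ?_
    have hxz : x = 0 := dotProduct_star_self_eq_zero.mp h
    rw [projMat, mul_vecMulVec, ← hx, hxz, zero_vecMulVec]
  set s := star x ⬝ᵥ x with hs
  have hsstar : star s = s := (star_dotProduct x x).symm
  have hNmem : s⁻¹ • projMat x ∈ inducedAlg H := by
    rw [hxx]
    exact Subalgebra.smul_mem _
      (mul_mem (mul_mem hGmem hwmem) (conjTranspose_mem_inducedAlg hH hGmem)) _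
  have hsum : 1 - projMat v - projMat w - s⁻¹ • projMat x = 0 := by
    refine one_sub_projections_eq_zero hd (projMat_mul_self hv) hQQ ?_
      (conjTranspose_projMat v) hQh ?_ ?_ ?_ ?_ (trace_projMat hv) (trace_projMat hw) ?_
    · rw [smul_mul_smul_comm, projMat_mul_projMat, ← hs, smul_smul, projMat, mul_assoc,
        inv_mul_cancel₀ hx0, mul_one]
    · rw [conjTranspose_smul, conjTranspose_projMat, star_inv₀, hsstar]
    · rw [projMat_mul_projMat, hvw, zero_smul]
    · rw [mul_smul_comm, projMat.eq_1 x, mul_vecMulVec, hPx, zero_vecMulVec, smul_zero]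
    · rw [mul_smul_comm, projMat.eq_1 x, mul_vecMulVec, hQx, zero_vecMulVec, smul_zero]
    · rw [trace_smul, projMat, trace_vecMulVec, dotProduct_comm, ← hs, smul_eq_mul,
        inv_mul_cancel₀ hx0]
  have hPeq : projMat v = 1 - projMat w - s⁻¹ • projMat x := by
    rw [← sub_eq_zero, ← neg_eq_zero, ← hsum]
    abel
  refine ⟨v, hv, ?_, hvcomm⟩
  rw [hPeq]
  exact sub_mem (sub_mem (one_mem _) hwmem) hNmem

/-- In dimension at most three, a Hermitian operator acting nontrivially whose slices commute
with those of another such operator has a critical subspace. -/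
lemma exists_isCriticalLine_of_commute {d : ℕ} (hd : d ≤ 3) {W W' : Type}
    {H : Matrix (Fin d × W) (Fin d × W) ℂ} {K : Matrix (Fin d × W') (Fin d × W') ℂ}
    (hH : H.IsHermitian) (hK : K.IsHermitian)
    (hHK : ∀ k l m n, Commute (sliceMat H k l) (sliceMat K m n))
    (hHnt : ¬ ActsTrivFst H) (hKnt : ¬ ActsTrivFst K) : ∃ u, IsCriticalLine H u := by
  obtain ⟨w, hw, hwmem⟩ := exists_projMat_mem_inducedAlg hd hH hHnt
  obtain ⟨v, hv, hvmem⟩ := exists_projMat_mem_inducedAlg hd hK hKnt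
  exact exists_isCriticalLine_of_projMat hd hH hv
    (fun X hX => (commute_of_mem_inducedAlg hHK hX hvmem).symm) hw hwmem

/-- A line is preserved by an operator whose slices commute with its orthogonal projection. -/
lemma preservesLine_of_commute {d : ℕ} {W : Type} [Fintype W] [DecidableEq W]
    {H : Matrix (Fin d × W) (Fin d × W) ℂ} {v : Fin d → ℂ} (hv : star v ⬝ᵥ v = 1)
    (hcomm : ∀ k l, Commute (projMat v) (sliceMat H k l)) : PreservesLine H v := by
  have hPH : (projMat v ⊗ₖ (1 : Matrix W W ℂ)) * H = H * (projMat v ⊗ₖ (1 : Matrix W W ℂ)) := by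
    ext ⟨i, k⟩ ⟨j, l⟩
    have h := congrFun (congrFun (hcomm k l).eq i) j
    simpa [mul_apply, Fintype.sum_prod_type, sliceMat, one_apply] using h
  rw [PreservesLine, ← mul_assoc, hPH, mul_assoc, ← mul_kronecker_mul, projMat_mul_self hv, one_mul]

/-- A critical line of an operator is preserved by any operator with commuting slices. -/
lemma IsCriticalLine.preservesLine {d : ℕ} {W W' : Type} [Fintype W'] [DecidableEq W']
    {H : Matrix (Fin d × W) (Fin d × W) ℂ} {K : Matrix (Fin d × W') (Fin d × W') ℂ}
    (hHK : ∀ k l m n, Commute (sliceMat H k l) (sliceMat K m n)) {v : Fin d → ℂ}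
    (hv : IsCriticalLine H v) : PreservesLine K v :=
  preservesLine_of_commute hv.1 fun k l =>
    commute_of_mem_inducedAlg hHK hv.2.1 (Algebra.subset_adjoin ⟨k, l, rfl⟩)

lemma isHermitian_liftL {d e₁ e₂ : ℕ} {M : Matrix (Fin d × Fin e₁) (Fin d × Fin e₁) ℂ}
    (hM : M.IsHermitian) : (liftL (e₂ := e₂) M).IsHermitian := by
  refine IsHermitian.ext fun p q => ?_
  simp [liftL, hM.apply, eq_comm, apply_ite star]

lemma isHermitian_liftR {d e₁ e₂ : ℕ} {M : Matrix (Fin d × Fin e₂) (Fin d × Fin e₂) ℂ}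
    (hM : M.IsHermitian) : (liftR (e₁ := e₁) M).IsHermitian := by
  refine IsHermitian.ext fun p q => ?_
  simp [liftR, hM.apply, eq_comm, apply_ite star]

/-- If the lifts of two operators on `H_q ⊗ E₁` and `H_q ⊗ E₂` commute, so do their slices. -/
lemma commute_sliceMat_of_commute_lift {d e₁ e₂ : ℕ}
    {M : Matrix (Fin d × Fin e₁) (Fin d × Fin e₁) ℂ}
    {N : Matrix (Fin d × Fin e₂) (Fin d × Fin e₂) ℂ}
    (hMN : Commute (liftL (e₂ := e₂) M) (liftR (e₁ := e₁) N)) (k l m n : Fin e₁ × Fin e₂) :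
    Commute (sliceMat (liftL M) k l) (sliceMat (liftR N) m n) := by
  obtain ⟨k, k'⟩ := k
  obtain ⟨l, l'⟩ := l
  obtain ⟨m, m'⟩ := m
  obtain ⟨n, n'⟩ := n
  by_cases hkl : k' = l'
  swap
  · have h0 : sliceMat (liftL M) (k, k') (l, l') = 0 := by
      ext i j
      simp [sliceMat, liftL, hkl]
    exact h0 ▸ Commute.zero_left _
  by_cases hmn : m = n
  swap
  · have h0 : sliceMat (liftR N) (m, m') (n, n') = 0 := by
      ext i j
      simp [sliceMat, liftR, hmn]
    exact h0 ▸ Commute.zero_right _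
  ext i j
  have h := congrFun (congrFun hMN.eq (i, k, m')) (j, l, n')
  simpa [mul_apply, Fintype.sum_prod_type, sliceMat, liftL, liftR, hkl, hmn] using h

/-- Fact 5.6.  Let `dim H_q ≤ 3`, `H₁ = H̃₁ ⊗ I_{E₂}` and `H₂`
corresponding to `H̃₂ ⊗ I_{E₁}` with `H̃₁, H̃₂` self-adjoint; assume `H₁` and `H₂` commute
and each acts nontrivially on `H_q`.  Then each of `H₁`, `H₂` has at least one critical
subspace on `H_q`, every critical subspace of `H₁` on `H_q` is preserved by `H₂`, and
symmetrically every critical subspace of `H₂` on `H_q` is preserved by `H₁`. -/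
theorem butterfly_partners_have_critical_subspaces
    {dq e₁ e₂ : ℕ} (hdq : dq ≤ 3)
    (H1 : Matrix (Fin dq × Fin e₁) (Fin dq × Fin e₁) ℂ)
    (H2 : Matrix (Fin dq × Fin e₂) (Fin dq × Fin e₂) ℂ)
    (h1sa : H1.IsHermitian) (h2sa : H2.IsHermitian)
    (hcomm : Commute (liftL (e₂ := e₂) H1) (liftR (e₁ := e₁) H2))
    (h1nt : ¬ ActsTrivFst (liftL (e₂ := e₂) H1))
    (h2nt : ¬ ActsTrivFst (liftR (e₁ := e₁) H2)) :
    ((∃ v, IsCriticalLine (liftL (e₂ := e₂) H1) v) ∧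
      (∃ v, IsCriticalLine (liftR (e₁ := e₁) H2) v)) ∧
    (∀ v, IsCriticalLine (liftL (e₂ := e₂) H1) v → PreservesLine (liftR (e₁ := e₁) H2) v) ∧
    (∀ v, IsCriticalLine (liftR (e₁ := e₁) H2) v → PreservesLine (liftL (e₂ := e₂) H1) v) := by
  have hLR := commute_sliceMat_of_commute_lift hcomm
  have hRL : ∀ k l m n, Commute (sliceMat (liftR (e₁ := e₁) H2) k l)
      (sliceMat (liftL (e₂ := e₂) H1) m n) := fun k l m n => (hLR m n k l).symm
  have h1 := isHermitian_liftL (e₂ := e₂) h1sa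
  have h2 := isHermitian_liftR (e₁ := e₁) h2sa
  exact ⟨⟨exists_isCriticalLine_of_commute hdq h1 h2 hLR h1nt h2nt,
      exists_isCriticalLine_of_commute hdq h2 h1 hRL h2nt h1nt⟩,
    fun _ hv => hv.preservesLine hLR, fun _ hv => hv.preservesLine hRL⟩
end

section
/- Let H_q, E₁, E₂ be finite-dimensional complex Hilbert spaces with dim H_q ≤ 3. Let H₁ = H̃₁ ⊗ I_{E₂} for a self-adjoint operator H̃₁ on H_q ⊗ E₁, and let H₂ be the operator on H_q ⊗ E₁ ⊗ E₂ corresponding, under the canonical permutation of tensor factors, to H̃₂ ⊗ I_{E₁} for a self-adjoint operator H̃₂ on H_q ⊗ E₂. Assume H₁ and H₂ commute and that each acts nontrivially on H_q. If S₁ is a critical subspace of H₁ on H_q and S₂ is a critical subspace of H₂ on H_q, then either S₁ = S₂ or S₁ is orthogonal to S₂. (Fact 5.7: critical subspaces of butterfly partners are either identical or orthogonal.) -/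
open Matrix Kronecker

/-- Commuting operators `M ⊗ I` and `N ⊗ I` sharing only the factor `H_q` have commuting slices. -/
theorem commute_sliceMat_of_commute_lift_s15 {dq e₁ e₂ : ℕ}
    {M : Matrix (Fin dq × Fin e₁) (Fin dq × Fin e₁) ℂ}
    {N : Matrix (Fin dq × Fin e₂) (Fin dq × Fin e₂) ℂ}
    (h : Commute (liftL (e₂ := e₂) M) (liftR (e₁ := e₁) N))
    (a a' : Fin e₁) (b b' : Fin e₂) : Commute (sliceMat M a a') (sliceMat N b b') := by
  ext i j
  have hij := congrFun (congrFun h.eq (i, a, b)) (j, a', b')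
  simpa [Matrix.mul_apply, liftL, liftR, sliceMat, Fintype.sum_prod_type] using hij

theorem sliceMat_liftL {dq e₁ e₂ : ℕ} (M : Matrix (Fin dq × Fin e₁) (Fin dq × Fin e₁) ℂ)
    (k l : Fin e₁ × Fin e₂) :
    sliceMat (liftL M) k l = (if k.2 = l.2 then (1 : ℂ) else 0) • sliceMat M k.1 l.1 := by
  ext i j
  simp [sliceMat, liftL]

theorem sliceMat_liftR {dq e₁ e₂ : ℕ} (N : Matrix (Fin dq × Fin e₂) (Fin dq × Fin e₂) ℂ)
    (k l : Fin e₁ × Fin e₂) :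
    sliceMat (liftR N) k l = (if k.1 = l.1 then (1 : ℂ) else 0) • sliceMat N k.2 l.2 := by
  ext i j
  simp [sliceMat, liftR]

/-- The algebras induced on `H_q` by commuting `M ⊗ I` and `N ⊗ I` commute elementwise. -/
theorem commute_of_mem_inducedAlg_lift {dq e₁ e₂ : ℕ}
    {M : Matrix (Fin dq × Fin e₁) (Fin dq × Fin e₁) ℂ}
    {N : Matrix (Fin dq × Fin e₂) (Fin dq × Fin e₂) ℂ}
    (h : Commute (liftL (e₂ := e₂) M) (liftR (e₁ := e₁) N))
    {X Y : Matrix (Fin dq) (Fin dq) ℂ}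
    (hX : X ∈ inducedAlg (liftL (e₂ := e₂) M)) (hY : Y ∈ inducedAlg (liftR (e₁ := e₁) N)) :
    Commute X Y := by
  refine Algebra.commute_of_mem_adjoin_of_forall_mem_commute hY ?_
  rintro _ ⟨k, l, rfl⟩
  refine (Algebra.commute_of_mem_adjoin_of_forall_mem_commute hX ?_).symm
  rintro _ ⟨k', l', rfl⟩
  rw [sliceMat_liftL, sliceMat_liftR]
  exact ((commute_sliceMat_of_commute_lift_s15 h _ _ _ _).smul_left _).smul_right _ |>.symm

/-- Lines whose rank-one projections commute are identical or orthogonal. -/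
theorem eq_smul_or_dotProduct_eq_zero_of_commute_projMat {m : ℕ} {v w : Fin m → ℂ}
    (hv : star v ⬝ᵥ v = 1) (h : Commute (projMat v) (projMat w)) :
    (∃ c : ℂ, w = c • v) ∨ star v ⬝ᵥ w = 0 := by
  by_cases hvw : star v ⬝ᵥ w = 0
  · exact Or.inr hvw
  have hwv : star w ⬝ᵥ v ≠ 0 := by
    rwa [star_dotProduct, star_ne_zero]
  refine Or.inl ⟨star v ⬝ᵥ w, smul_right_injective _ hwv ?_⟩
  have happ := congrArg (· *ᵥ v) h.eq
  simpa [projMat, ← Matrix.mulVec_mulVec, Matrix.vecMulVec_mulVec, hv, Matrix.mulVec_smul]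
    using happ.symm

/-- Fact 5.7.  Let `dim H_q ≤ 3`, `H₁ = H̃₁ ⊗ I_{E₂}` and `H₂`
corresponding to `H̃₂ ⊗ I_{E₁}` with `H̃₁, H̃₂` self-adjoint; assume `H₁` and `H₂` commute
and each acts nontrivially on `H_q`.  If `S₁ = ℂv₁` is a critical subspace of `H₁` on `H_q`
and `S₂ = ℂv₂` is a critical subspace of `H₂` on `H_q`, then either `S₁ = S₂` (the unit
vectors are proportional) or `S₁ ⊥ S₂`. -/
theorem critical_subspaces_identical_or_orthogonal
    {dq e₁ e₂ : ℕ} (hdq : dq ≤ 3)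
    (H1 : Matrix (Fin dq × Fin e₁) (Fin dq × Fin e₁) ℂ)
    (H2 : Matrix (Fin dq × Fin e₂) (Fin dq × Fin e₂) ℂ)
    (h1sa : H1.IsHermitian) (h2sa : H2.IsHermitian)
    (hcomm : Commute (liftL (e₂ := e₂) H1) (liftR (e₁ := e₁) H2))
    (h1nt : ¬ ActsTrivFst (liftL (e₂ := e₂) H1))
    (h2nt : ¬ ActsTrivFst (liftR (e₁ := e₁) H2)) :
    ∀ v₁ v₂ : Fin dq → ℂ,
      IsCriticalLine (liftL (e₂ := e₂) H1) v₁ →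
      IsCriticalLine (liftR (e₁ := e₁) H2) v₂ →
      (∃ c : ℂ, v₂ = c • v₁) ∨ star v₁ ⬝ᵥ v₂ = 0 := by
  intro v₁ v₂ hv₁ hv₂
  exact eq_smul_or_dotProduct_eq_zero_of_commute_projMat hv₁.1
    (commute_of_mem_inducedAlg_lift hcomm hv₁.2.1 hv₂.2.1)
end

section
/- Let V be a complex Hilbert space with dim V ≤ 3 and E a finite-dimensional complex Hilbert space, and let H be a self-adjoint operator on V ⊗ E acting nontrivially on V. Let Π be an orthogonal projection on V lying in the center of the algebra induced by H on V, and let S₀ be a one-dimensional subspace of V such that Π does not preserve S₀ (i.e., Π(S₀) is not contained in S₀). Then H has a critical subspace S₊ on V such that S₀ and S₊ are neither orthogonal nor equal. (Fact 5.9.) -/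
open Matrix Kronecker

open scoped ComplexOrder in
/-- An orthogonal projection of rank at most one that does not vanish at `u` is the projection
onto the line spanned by a unit vector. -/
lemma exists_eq_projMat_of_rank_le_one {m : ℕ} {Q : Matrix (Fin m) (Fin m) ℂ}
    (hQ : Q.IsHermitian) (hQQ : Q * Q = Q) (hrank : Q.rank ≤ 1)
    {u : Fin m → ℂ} (hu : Q *ᵥ u ≠ 0) :
    ∃ v : Fin m → ℂ, star v ⬝ᵥ v = 1 ∧ Q = projMat v := by
  obtain ⟨r, hr, hru⟩ : ∃ r : ℝ, r ≠ 0 ∧ star (Q *ᵥ u) ⬝ᵥ (Q *ᵥ u) = (r : ℂ) ^ 2 := by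
    have hpos : 0 < star (Q *ᵥ u) ⬝ᵥ (Q *ᵥ u) := dotProduct_star_self_pos_iff.mpr hu
    obtain ⟨hre, him⟩ := Complex.pos_iff.mp hpos
    refine ⟨√(star (Q *ᵥ u) ⬝ᵥ (Q *ᵥ u)).re, (Real.sqrt_pos.mpr hre).ne', ?_⟩
    rw [← Complex.ofReal_pow, Real.sq_sqrt hre.le]
    exact Complex.ext rfl him.symm
  have hrc : (r : ℂ) ≠ 0 := Complex.ofReal_ne_zero.mpr hr
  set v : Fin m → ℂ := (r : ℂ)⁻¹ • (Q *ᵥ u) with hv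
  have hunit : star v ⬝ᵥ v = 1 := by
    rw [hv, star_smul, smul_dotProduct, dotProduct_smul, hru]
    simp only [star_inv₀, Complex.star_def, Complex.conj_ofReal, smul_eq_mul]
    field_simp
  have hQv : Q *ᵥ v = v := by
    rw [hv, mulVec_smul, mulVec_mulVec, hQQ]
  have hstarQ : star v ᵥ* Q = star v := by
    have h := congrArg star hQv
    rwa [star_mulVec, hQ.eq] at h
  refine ⟨v, hunit, ext_of_mulVec_single fun j => ?_⟩
  obtain ⟨w, hw⟩ := finrank_le_one_iff.mp (show Module.finrank ℂ Q.mulVecLin.range ≤ 1 from hrank)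
  obtain ⟨a, ha⟩ := hw ⟨v, v, hQv⟩
  obtain ⟨b, hb⟩ := hw ⟨Q *ᵥ Pi.single j 1, Pi.single j 1, rfl⟩
  replace ha : a • (w : Fin m → ℂ) = v := congrArg Subtype.val ha
  replace hb : b • (w : Fin m → ℂ) = Q *ᵥ Pi.single j 1 := congrArg Subtype.val hb
  have ha0 : a ≠ 0 := by
    rintro rfl
    rw [← ha] at hunit
    simp at hunit
  have hmul : Q *ᵥ Pi.single j 1 = (b / a) • v := by
    rw [← ha, ← hb, smul_smul, div_mul_cancel₀ _ ha0]
  have hcoef : b / a = star v ⬝ᵥ Pi.single j 1 := by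
    have h := congrArg (star v ⬝ᵥ ·) hmul
    simp only [dotProduct_mulVec, hstarQ, dotProduct_smul, hunit, smul_eq_mul, mul_one] at h
    exact h.symm
  rw [hmul, hcoef, projMat, vecMulVec_mulVec, op_smul_eq_smul]

/-- A central orthogonal projection of rank at most one that does not preserve `ℂv₀` projects
onto a critical line that is neither orthogonal nor equal to `ℂv₀`. -/
lemma exists_isCriticalLine_of_rank_le_one {m : ℕ} {W : Type}
    {H : Matrix (Fin m × W) (Fin m × W) ℂ} {Q : Matrix (Fin m) (Fin m) ℂ}
    (hQ : Q.IsHermitian) (hQQ : Q * Q = Q) (hrank : Q.rank ≤ 1)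
    (hmem : Q ∈ inducedAlg H) (hcomm : ∀ X ∈ inducedAlg H, Commute Q X)
    {v₀ : Fin m → ℂ} (hnp : ¬ ∃ c : ℂ, Q *ᵥ v₀ = c • v₀) :
    ∃ v : Fin m → ℂ, IsCriticalLine H v ∧
      star v₀ ⬝ᵥ v ≠ 0 ∧ ¬ ∃ c : ℂ, v = c • v₀ := by
  have hne : Q *ᵥ v₀ ≠ 0 := fun h => hnp ⟨0, by rw [h, zero_smul]⟩
  obtain ⟨v, hv, rfl⟩ := exists_eq_projMat_of_rank_le_one hQ hQQ hrank hne
  have hproj : projMat v *ᵥ v₀ = (star v ⬝ᵥ v₀) • v := by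
    rw [projMat, vecMulVec_mulVec, op_smul_eq_smul]
  refine ⟨v, ⟨hv, hmem, hcomm⟩, fun h => hne ?_, ?_⟩
  · have h' : star v ⬝ᵥ v₀ = 0 := by
      rw [star_dotProduct, h, star_zero]
    rw [hproj, h', zero_smul]
  · rintro ⟨c, hc⟩
    exact hnp ⟨(star v ⬝ᵥ v₀) * c, by rw [hproj, mul_smul, ← hc]⟩

/-- The ranks of complementary idempotents sum to at most the dimension. -/
lemma rank_add_rank_one_sub_le {m : ℕ} {P : Matrix (Fin m) (Fin m) ℂ} (hP : P * P = P) :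
    P.rank + (1 - P).rank ≤ m := by
  simpa using rank_add_rank_le_card_of_mul_eq_zero
    (show P * (1 - P) = 0 by rw [mul_sub, mul_one, hP, sub_self])

/-- Fact 5.9.  Let `dim V ≤ 3`, `E` finite-dimensional, `H` a
self-adjoint operator on `V ⊗ E` acting nontrivially on `V`, and `Π` an orthogonal
projection on `V` lying in the center of the algebra induced by `H` on `V`.  If `Π` does
not preserve a one-dimensional subspace `S₀ = ℂv₀` (i.e. `Π v₀ ∉ ℂ v₀`), then `H` has a
critical subspace `S₊ = ℂv₊` on `V` that is neither orthogonal nor equal to `S₀`. -/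
theorem nonpreserved_line_gives_skew_critical_subspace
    {dq e : ℕ} (hdq : dq ≤ 3)
    (H : Matrix (Fin dq × Fin e) (Fin dq × Fin e) ℂ)
    (hsa : H.IsHermitian)
    (hnt : ¬ ActsTrivFst H)
    (Pr : Matrix (Fin dq) (Fin dq) ℂ)
    (hPsa : Pr.IsHermitian) (hPproj : Pr * Pr = Pr)
    (hPmem : Pr ∈ inducedAlg H)
    (hPcenter : ∀ X ∈ inducedAlg H, Commute Pr X)
    (v₀ : Fin dq → ℂ) (hv₀ : star v₀ ⬝ᵥ v₀ = 1)
    (hnp : ¬ ∃ c : ℂ, Pr.mulVec v₀ = c • v₀) :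
    ∃ vp : Fin dq → ℂ, IsCriticalLine H vp ∧
      star v₀ ⬝ᵥ vp ≠ 0 ∧ ¬ ∃ c : ℂ, vp = c • v₀ := by
  have hrank := rank_add_rank_one_sub_le hPproj
  rcases le_or_gt Pr.rank 1 with h | h
  · exact exists_isCriticalLine_of_rank_le_one hPsa hPproj h hPmem hPcenter hnp
  · refine exists_isCriticalLine_of_rank_le_one (Q := 1 - Pr) (isHermitian_one.sub hPsa) ?_
      (by omega) (sub_mem (one_mem _) hPmem)
      (fun X hX => (Commute.one_left X).sub_left (hPcenter X hX)) ?_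
    · rw [mul_sub, sub_mul, sub_mul, hPproj]
      simp
    · rintro ⟨c, hc⟩
      refine hnp ⟨1 - c, ?_⟩
      rw [sub_smul, ← hc, sub_mulVec, one_mulVec, one_smul, sub_sub_cancel]
end

section
/- Let H_q, H_{a₁}, …, H_{a₆} be finite-dimensional complex Hilbert spaces with 2 ≤ dim H_q ≤ 3, with total space H_q ⊗ H_{a₁} ⊗ ⋯ ⊗ H_{a₆}. For i = 1, …, 5 let H_i be a self-adjoint operator on the total space which, under the canonical tensor-factor identification, equals an operator on H_q ⊗ H_{a_i} ⊗ H_{a_{i+1}} tensored with the identity on all other factors. Assume the five operators pairwise commute and that each acts nontrivially on H_q. Then there exists a subspace S of H_q with 0 ≠ S ≠ H_q such that every H_i commutes with (the orthogonal projection of H_q onto S) ⊗ (identity on the remaining factors); that is, all five operators of the open operator path agree on a common nontrivial direct-sum decomposition of H_q. (The key step proved inside Lemma 5.11: the operators of a length-5 open operator path on a qudit of dimension at most 3 preserve a common nontrivial decomposition.) -/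
open Matrix Kronecker

/-- The rank-one matrix `v vᴴ`. -/
def rankOne {d : ℕ} (v : Fin d → ℂ) : Matrix (Fin d) (Fin d) ℂ := vecMulVec v (star v)

lemma rankOne_isHermitian {d : ℕ} (v : Fin d → ℂ) : (rankOne v).IsHermitian := by
  simp [rankOne, IsHermitian, conjTranspose_vecMulVec]

lemma rankOne_mul_self {d : ℕ} {v : Fin d → ℂ} (hv : star v ⬝ᵥ v = 1) :
    rankOne v * rankOne v = rankOne v := by
  simp [rankOne, vecMulVec_mul_vecMulVec, hv]

lemma trace_rankOne {d : ℕ} {v : Fin d → ℂ} (hv : star v ⬝ᵥ v = 1) :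
    (rankOne v).trace = 1 := by
  rw [rankOne, trace_vecMulVec, dotProduct_comm, hv]

lemma rankOne_eq_of_eq_smul {d : ℕ} {v w : Fin d → ℂ} {c : ℂ} (hv : star v ⬝ᵥ v = 1)
    (hw : star w ⬝ᵥ w = 1) (hc : v = c • w) : rankOne v = rankOne w := by
  have hcc : c * star c = 1 := by
    rw [hc] at hv
    simpa [hw, mul_comm] using hv
  rw [hc, rankOne, rankOne, star_smul, smul_vecMulVec, vecMulVec_smul, smul_smul, hcc, one_smul]

/-- Commuting rank-one projections are equal or orthogonal. -/
lemma rankOne_eq_or_orthogonal {d : ℕ} {v w : Fin d → ℂ} (hv : star v ⬝ᵥ v = 1)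
    (hw : star w ⬝ᵥ w = 1) (h : Commute (rankOne v) (rankOne w)) :
    rankOne v = rankOne w ∨ star v ⬝ᵥ w = 0 := by
  refine or_iff_not_imp_right.mpr fun hne => ?_
  have hvw : (star v ⬝ᵥ w) • v = (star w ⬝ᵥ v * (star v ⬝ᵥ w)) • w := by
    have := congrArg (· *ᵥ w) h.eq
    simpa [rankOne, ← mulVec_mulVec, vecMulVec_mulVec, hw, mulVec_smul, smul_smul,
      mul_comm] using this
  obtain ⟨c, hc⟩ : ∃ c : ℂ, v = c • w := by
    refine ⟨(star v ⬝ᵥ w)⁻¹ * (star w ⬝ᵥ v * (star v ⬝ᵥ w)), ?_⟩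
    rw [← smul_smul, ← hvw, smul_smul, inv_mul_cancel₀ hne, one_smul]
  exact rankOne_eq_of_eq_smul hv hw hc

/-- Three pairwise orthogonal unit vectors in dimension three resolve the identity. -/
lemma rankOne_add_add_eq_one {u v w : Fin 3 → ℂ} (hu : star u ⬝ᵥ u = 1)
    (hv : star v ⬝ᵥ v = 1) (hw : star w ⬝ᵥ w = 1) (huv : star u ⬝ᵥ v = 0)
    (huw : star u ⬝ᵥ w = 0) (hvw : star v ⬝ᵥ w = 0) :
    rankOne u + rankOne v + rankOne w = 1 := by
  have hvu : star v ⬝ᵥ u = 0 := by rw [star_dotProduct, huv, star_zero]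
  have hwu : star w ⬝ᵥ u = 0 := by rw [star_dotProduct, huw, star_zero]
  have hwv : star w ⬝ᵥ v = 0 := by rw [star_dotProduct, hvw, star_zero]
  have h : (of ![u, v, w])ᵀᴴ * (of ![u, v, w])ᵀ = 1 := by
    ext i j
    rw [mul_apply']
    change star ((![u, v, w]) i) ⬝ᵥ ((![u, v, w]) j) = _
    fin_cases i <;> fin_cases j <;> simp [*]
  rw [← mul_eq_one_comm.mp h]
  ext i j
  simp [rankOne, vecMulVec_apply, mul_apply, Fin.sum_univ_three]

open scoped ComplexOrder in
lemma exists_smul_dotProduct_eq_one {d : ℕ} {w : Fin d → ℂ} (hw : w ≠ 0) :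
    ∃ c : ℂ, star (c • w) ⬝ᵥ (c • w) = 1 := by
  have hpos : 0 < star w ⬝ᵥ w := dotProduct_star_self_pos_iff.mpr hw
  obtain ⟨r, hr⟩ : ∃ r : ℝ, star w ⬝ᵥ w = r := ⟨_, Complex.eq_re_of_ofReal_le hpos.le⟩
  rw [hr] at hpos
  have hr0 : 0 < r := by exact_mod_cast hpos
  refine ⟨((√r)⁻¹ : ℝ), ?_⟩
  rw [star_smul, smul_dotProduct, dotProduct_smul, hr, smul_smul, Complex.star_def,
    Complex.conj_ofReal, smul_eq_mul, ← Complex.ofReal_mul, ← Complex.ofReal_mul, ← mul_inv,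
    Real.mul_self_sqrt hr0.le, inv_mul_cancel₀ hr0.ne', Complex.ofReal_one]

/-- In dimension three, the orthogonal complement of two distinct lines is a line. -/
lemma rankOne_eq_of_orthogonal {v₁ v₂ w₁ w₂ : Fin 3 → ℂ}
    (hv₁ : star v₁ ⬝ᵥ v₁ = 1) (hv₂ : star v₂ ⬝ᵥ v₂ = 1)
    (hw₁ : star w₁ ⬝ᵥ w₁ = 1) (hw₂ : star w₂ ⬝ᵥ w₂ = 1)
    (h₁₁ : star v₁ ⬝ᵥ w₁ = 0) (h₁₂ : star v₁ ⬝ᵥ w₂ = 0)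
    (h₂₁ : star v₂ ⬝ᵥ w₁ = 0) (h₂₂ : star v₂ ⬝ᵥ w₂ = 0) :
    rankOne v₁ = rankOne v₂ ∨ rankOne w₁ = rankOne w₂ := by
  refine or_iff_not_imp_right.mpr fun hne => ?_
  have hw' : w₂ - (star w₁ ⬝ᵥ w₂) • w₁ ≠ 0 := fun h =>
    hne (rankOne_eq_of_eq_smul hw₂ hw₁ (sub_eq_zero.mp h)).symm
  obtain ⟨c, hc⟩ := exists_smul_dotProduct_eq_one hw'
  have key : ∀ v : Fin 3 → ℂ, star v ⬝ᵥ v = 1 → star v ⬝ᵥ w₁ = 0 → star v ⬝ᵥ w₂ = 0 →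
      rankOne v + rankOne w₁ + rankOne (c • (w₂ - (star w₁ ⬝ᵥ w₂) • w₁)) = 1 :=
    fun v hv h₁ h₂ => rankOne_add_add_eq_one hv hw₁ hc h₁ (by simp [h₁, h₂]) (by simp [hw₁])
  have := (key v₁ hv₁ h₁₁ h₁₂).trans (key v₂ hv₂ h₂₁ h₂₂).symm
  exact add_right_cancel (add_right_cancel this)

lemma commute_conj_iff {d : ℕ} {U M Y : Matrix (Fin d) (Fin d) ℂ} (hU : Uᴴ * U = 1) :
    Commute (U * M * Uᴴ) Y ↔ Commute M (Uᴴ * Y * U) := by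
  have hU' : U * Uᴴ = 1 := mul_eq_one_comm.mp hU
  constructor
  · intro h
    have := congrArg (fun Z => Uᴴ * Z * U) h.eq
    simpa [Commute, SemiconjBy, Matrix.mul_assoc, hU, ← Matrix.mul_assoc Uᴴ U] using this
  · intro h
    have := congrArg (fun Z => U * Z * Uᴴ) h.eq
    simpa [Commute, SemiconjBy, Matrix.mul_assoc, hU', ← Matrix.mul_assoc U Uᴴ] using this

lemma apply_eq_zero_of_commute_diagonal {d : ℕ} {l : Fin d → ℂ} {Y : Matrix (Fin d) (Fin d) ℂ}
    (h : Commute (diagonal l) Y) {i j : Fin d} (hij : l i ≠ l j) : Y i j = 0 := by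
  have := congrFun (congrFun h.eq i) j
  rw [diagonal_mul, mul_diagonal, mul_comm, ← sub_eq_zero, ← mul_sub] at this
  exact (mul_eq_zero.mp this).resolve_right (sub_ne_zero.mpr hij)

/-- A nonconstant function on at most three points has a value attained exactly once, and is either
injective or constant off that point. -/
lemma exists_simple_value {d : ℕ} (hd2 : 2 ≤ d) (hd3 : d ≤ 3) (l : Fin d → ℂ)
    (hl : ¬ ∃ c, ∀ i, l i = c) :
    ∃ k, (∀ j, j ≠ k → l j ≠ l k) ∧
      (Function.Injective l ∨ d = 3 ∧ ∃ c, ∀ j, j ≠ k → l j = c) := by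
  interval_cases d
  · have h : l 0 ≠ l 1 := fun h => hl ⟨l 0, by simp [Fin.forall_fin_two, h]⟩
    refine ⟨0, by simp [Fin.forall_fin_two, h.symm], Or.inl ?_⟩
    simp [Function.Injective, Fin.forall_fin_two, h, h.symm]
  · simp only [Fin.forall_fin_succ, Fin.exists_fin_succ, Function.Injective] at *
    simp at *
    grind

/-- A non-scalar Hermitian matrix of size at most three has a one-dimensional spectral projection;
either its commutant is commutative, or it has the same commutant as that projection. -/
lemma exists_rankOne_of_isHermitian {d : ℕ} (hd2 : 2 ≤ d) (hd3 : d ≤ 3)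
    {X : Matrix (Fin d) (Fin d) ℂ} (hX : X.IsHermitian) (hns : ∀ c : ℂ, X ≠ c • 1) :
    ∃ v : Fin d → ℂ, star v ⬝ᵥ v = 1 ∧ (∀ Y, Commute X Y → Commute (rankOne v) Y) ∧
      ((∀ Y Z, Commute X Y → Commute X Z → Commute Y Z) ∨
        d = 3 ∧ ∀ Y, Commute (rankOne v) Y → Commute X Y) := by
  obtain ⟨U, l, hU, hXU⟩ : ∃ (U : Matrix (Fin d) (Fin d) ℂ) (l : Fin d → ℂ),
      Uᴴ * U = 1 ∧ X = U * diagonal l * Uᴴ :=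
    ⟨hX.eigenvectorUnitary, _, Unitary.coe_star_mul_self _, by
      conv_lhs => rw [hX.spectral_theorem]
      rfl⟩
  have hU' : U * Uᴴ = 1 := mul_eq_one_comm.mp hU
  obtain ⟨k, hk, hl⟩ := exists_simple_value hd2 hd3 l (by
    rintro ⟨c, hc⟩
    apply hns c
    rw [hXU, show l = fun _ => c from funext hc, ← smul_one_eq_diagonal]
    simp [hU'])
  have hR : rankOne (U.col k) = U * single k k 1 * Uᴴ := by
    ext i j
    simp [rankOne, vecMulVec_apply, mul_apply, single_apply, ite_and]
  refine ⟨U.col k, ?_, ?_, ?_⟩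
  · simpa [mul_apply, dotProduct] using congrFun (congrFun hU k) k
  · intro Y hY
    rw [hXU, commute_conj_iff hU] at hY
    rw [hR, commute_conj_iff hU]
    have h1 : ∀ j, j ≠ k → (Uᴴ * Y * U) j k = 0 := fun j hj =>
      apply_eq_zero_of_commute_diagonal hY (hk j hj)
    have h2 : ∀ j, j ≠ k → (Uᴴ * Y * U) k j = 0 := fun j hj =>
      apply_eq_zero_of_commute_diagonal hY (hk j hj).symm
    generalize Uᴴ * Y * U = W at *
    rw [← diagonal_single]
    ext i j
    rw [diagonal_mul, mul_diagonal]
    by_cases hi : i = k <;> by_cases hj : j = k <;> simp_all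
  · refine hl.imp (fun hinj Y Z hY hZ => ?_) fun ⟨hd, c, hc⟩ => ⟨hd, fun Y hY => ?_⟩
    · rw [hXU, commute_conj_iff hU] at hY hZ
      have hdiag : ∀ W, Commute (diagonal l) W → W = diagonal W.diag := fun W hW => by
        ext i j
        by_cases hij : i = j
        · simp [hij]
        · rw [apply_eq_zero_of_commute_diagonal hW (hinj.ne hij), diagonal_apply_ne _ hij]
      have h : Commute (Uᴴ * Y * U) (Uᴴ * Z * U) := by
        rw [hdiag _ hY, hdiag _ hZ]
        exact commute_diagonal _ _
      rw [← commute_conj_iff hU] at h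
      simpa [Matrix.mul_assoc, hU', ← Matrix.mul_assoc U Uᴴ] using h
    · rw [hR, commute_conj_iff hU] at hY
      rw [hXU, commute_conj_iff hU]
      have : diagonal l = c • 1 + (l k - c) • single k k (1 : ℂ) := by
        rw [← diagonal_single]
        ext i j
        by_cases hij : i = j
        · subst hij
          by_cases hi : i = k
          · simp [hi]
          · simp [hi, hc i hi]
        · simp [hij]
      rw [this]
      exact ((Commute.one_left _).smul_left c).add_left (hY.smul_left _)

/-- Five families of Hermitian matrices of size at most three, each containing a non-scalar matrix
and with non-consecutive families commuting, have a common commuting rank-one projection. -/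
lemma exists_common_rankOne {d : ℕ} (hd2 : 2 ≤ d) (hd3 : d ≤ 3)
    (A : Fin 5 → Set (Matrix (Fin d) (Fin d) ℂ)) (hA : ∀ i, ∀ X ∈ A i, X.IsHermitian)
    (hcomm : ∀ i k : Fin 5, i.val + 1 < k.val → ∀ X ∈ A i, ∀ Y ∈ A k, Commute X Y)
    (hns : ∀ i, ∃ X ∈ A i, ∀ c : ℂ, X ≠ c • 1) :
    ∃ v : Fin d → ℂ, star v ⬝ᵥ v = 1 ∧ ∀ i, ∀ X ∈ A i, Commute (rankOne v) X := by
  have hcomm' : ∀ i k : Fin 5, i.val + 1 < k.val → ∀ X ∈ A k, ∀ Y ∈ A i, Commute X Y :=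
    fun i k h X hX Y hY => (hcomm i k h Y hY X hX).symm
  by_contra hgoal
  -- A vector cannot give a projection commuting with every family.
  have hno : ∀ v : Fin d → ℂ, star v ⬝ᵥ v = 1 → (∀ X ∈ A 0, Commute (rankOne v) X) →
      (∀ X ∈ A 1, Commute (rankOne v) X) → (∀ X ∈ A 2, Commute (rankOne v) X) →
      (∀ X ∈ A 3, Commute (rankOne v) X) → (∀ X ∈ A 4, Commute (rankOne v) X) → False :=
    fun v hv h0 h1 h2 h3 h4 => hgoal ⟨v, hv, fun i => by fin_cases i <;> assumption⟩
  have hstep : ∀ i, (∀ j, ∀ X ∈ A i, ∀ Y ∈ A j, Commute X Y) → False := by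
    intro i h
    obtain ⟨X, hX, hXns⟩ := hns i
    obtain ⟨v, hv, hvX, -⟩ := exists_rankOne_of_isHermitian hd2 hd3 (hA i X hX) hXns
    exact hgoal ⟨v, hv, fun j Y hY => hvX Y (h j X hX Y hY)⟩
  -- No matrix of an outer family has a commutative commutant.
  have hnc : ∀ i, i ≠ 2 → ∀ X ∈ A i, ¬ ∀ Y Z, Commute X Y → Commute X Z → Commute Y Z := by
    intro i hi X hX h
    fin_cases i
    · refine hstep 3 fun j Y hY Z hZ => ?_
      have hXY := hcomm 0 3 (by decide) X hX Y hY
      fin_cases j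
      · exact hcomm' 0 3 (by decide) Y hY Z hZ
      · exact hcomm' 1 3 (by decide) Y hY Z hZ
      · exact h Y Z hXY (hcomm 0 2 (by decide) X hX Z hZ)
      · exact h Y Z hXY (hcomm 0 3 (by decide) X hX Z hZ)
      · exact h Y Z hXY (hcomm 0 4 (by decide) X hX Z hZ)
    · refine hstep 4 fun j Y hY Z hZ => ?_
      have hXY := hcomm 1 4 (by decide) X hX Y hY
      fin_cases j
      · exact hcomm' 0 4 (by decide) Y hY Z hZ
      · exact hcomm' 1 4 (by decide) Y hY Z hZ
      · exact hcomm' 2 4 (by decide) Y hY Z hZ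
      · exact h Y Z hXY (hcomm 1 3 (by decide) X hX Z hZ)
      · exact h Y Z hXY (hcomm 1 4 (by decide) X hX Z hZ)
    · exact hi rfl
    · refine hstep 0 fun j Y hY Z hZ => ?_
      have hXY := hcomm' 0 3 (by decide) X hX Y hY
      fin_cases j
      · exact h Y Z hXY (hcomm' 0 3 (by decide) X hX Z hZ)
      · exact h Y Z hXY (hcomm' 1 3 (by decide) X hX Z hZ)
      · exact hcomm 0 2 (by decide) Y hY Z hZ
      · exact hcomm 0 3 (by decide) Y hY Z hZ
      · exact hcomm 0 4 (by decide) Y hY Z hZ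
    · refine hstep 1 fun j Y hY Z hZ => ?_
      have hXY := hcomm' 1 4 (by decide) X hX Y hY
      fin_cases j
      · exact h Y Z hXY (hcomm' 0 4 (by decide) X hX Z hZ)
      · exact h Y Z hXY (hcomm' 1 4 (by decide) X hX Z hZ)
      · exact h Y Z hXY (hcomm' 2 4 (by decide) X hX Z hZ)
      · exact hcomm 1 3 (by decide) Y hY Z hZ
      · exact hcomm 1 4 (by decide) Y hY Z hZ
  let V (i : Fin 5) (v : Fin d → ℂ) : Prop :=
    star v ⬝ᵥ v = 1 ∧ ∃ X ∈ A i, ∀ Y, Commute X Y → Commute (rankOne v) Y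
  have hV : ∀ i, i ≠ 2 → ∀ X ∈ A i, (∀ c : ℂ, X ≠ c • 1) →
      d = 3 ∧ ∃ v, V i v ∧ ∀ Y, Commute (rankOne v) Y → Commute X Y := by
    intro i hi X hX hXns
    obtain ⟨v, hv, hvX, h | ⟨hd, h⟩⟩ := exists_rankOne_of_isHermitian hd2 hd3 (hA i X hX) hXns
    · exact (hnc i hi X hX h).elim
    · exact ⟨hd, v, ⟨hv, X, hX, hvX⟩, h⟩
  have hVex : ∀ i, i ≠ 2 → ∃ v, V i v := fun i hi => by
    obtain ⟨X, hX, hXns⟩ := hns i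
    exact (hV i hi X hX hXns).2.imp fun v hv => hv.1
  obtain rfl : d = 3 := by
    obtain ⟨X, hX, hXns⟩ := hns 0
    exact (hV 0 (by decide) X hX hXns).1
  have hVr : ∀ i k : Fin 5, i.val + 1 < k.val → ∀ v, V i v → ∀ Y ∈ A k, Commute (rankOne v) Y :=
    fun i k hik v ⟨_, X, hX, hv⟩ Y hY => hv Y (hcomm i k hik X hX Y hY)
  have hVl : ∀ i k : Fin 5, i.val + 1 < k.val → ∀ v, V k v → ∀ Y ∈ A i, Commute (rankOne v) Y :=
    fun i k hik v ⟨_, X, hX, hv⟩ Y hY => hv Y (hcomm' i k hik X hX Y hY)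
  have hVV : ∀ i k : Fin 5, i.val + 1 < k.val → ∀ v w, V i v → V k w →
      rankOne v = rankOne w ∨ star v ⬝ᵥ w = 0 := fun i k hik v w hv hw => by
    obtain ⟨-, Y, hY, hYw⟩ := id hw
    exact rankOne_eq_or_orthogonal hv.1 hw.1 (hYw _ (hVr i k hik v hv Y hY).symm).symm
  have h03 : ∀ v w, V 0 v → V 3 w → star v ⬝ᵥ w = 0 := fun v w hv hw =>
    (hVV 0 3 (by decide) v w hv hw).resolve_left fun h => hno v hv.1
      (h ▸ hVl 0 3 (by decide) w hw) (h ▸ hVl 1 3 (by decide) w hw) (hVr 0 2 (by decide) v hv)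
      (hVr 0 3 (by decide) v hv) (hVr 0 4 (by decide) v hv)
  have h04 : ∀ v w, V 0 v → V 4 w → star v ⬝ᵥ w = 0 := fun v w hv hw =>
    (hVV 0 4 (by decide) v w hv hw).resolve_left fun h => hno v hv.1
      (h ▸ hVl 0 4 (by decide) w hw) (h ▸ hVl 1 4 (by decide) w hw) (hVr 0 2 (by decide) v hv)
      (hVr 0 3 (by decide) v hv) (hVr 0 4 (by decide) v hv)
  have h14 : ∀ v w, V 1 v → V 4 w → star v ⬝ᵥ w = 0 := fun v w hv hw =>
    (hVV 1 4 (by decide) v w hv hw).resolve_left fun h => hno v hv.1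
      (h ▸ hVl 0 4 (by decide) w hw) (h ▸ hVl 1 4 (by decide) w hw) (h ▸ hVl 2 4 (by decide) w hw)
      (hVr 1 3 (by decide) v hv) (hVr 1 4 (by decide) v hv)
  have h13 : ∀ v w, V 1 v → V 3 w → star v ⬝ᵥ w = 0 := fun v w hv hw =>
    (hVV 1 3 (by decide) v w hv hw).resolve_left fun h => by
      obtain ⟨u, hu⟩ := hVex 0 (by decide)
      obtain ⟨z, hz⟩ := hVex 4 (by decide)
      have hsum := rankOne_add_add_eq_one hu.1 hw.1 hz.1 (h03 u w hu hw) (h04 u z hu hz) (by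
        obtain ⟨-, Y, hY, hYz⟩ := id hz
        have hwz : Commute (rankOne w) (rankOne z) :=
          h ▸ (hYz _ (hVr 1 4 (by decide) v hv Y hY).symm).symm
        refine (rankOne_eq_or_orthogonal hw.1 hz.1 hwz).resolve_left fun hwz => ?_
        exact hno v hv.1 (h ▸ hVl 0 3 (by decide) w hw) (h ▸ hVl 1 3 (by decide) w hw)
          (h ▸ hwz ▸ hVl 2 4 (by decide) z hz) (hVr 1 3 (by decide) v hv)
          (hVr 1 4 (by decide) v hv))
      refine hno v hv.1 (h ▸ hVl 0 3 (by decide) w hw) (h ▸ hVl 1 3 (by decide) w hw)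
        (fun X hX => ?_) (hVr 1 3 (by decide) v hv) (hVr 1 4 (by decide) v hv)
      rw [h, show rankOne w = 1 - rankOne u - rankOne z by rw [← hsum]; abel]
      exact ((Commute.one_left X).sub_left (hVr 0 2 (by decide) u hu X hX)).sub_left
        (hVl 2 4 (by decide) z hz X hX)
  -- A family all of whose projections agree commutes with that projection.
  have hself : ∀ i, i ≠ 2 → ∀ v, (∀ w, V i w → rankOne w = rankOne v) →
      ∀ X ∈ A i, Commute (rankOne v) X := fun i hi v hv X hX => by
    by_cases hs : ∃ c : ℂ, X = c • 1
    · obtain ⟨c, rfl⟩ := hs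
      exact (Commute.one_right _).smul_right c
    · push Not at hs
      obtain ⟨-, w, hw, hwX⟩ := hV i hi X hX hs
      exact hv w hw ▸ (hwX _ (Commute.refl _)).symm
  have hdich : (∀ v w, V 0 v → V 1 w → rankOne v = rankOne w) ∨
      ∀ v w, V 3 v → V 4 w → rankOne v = rankOne w := by
    by_contra! ⟨⟨v, w, hv, hw, hne⟩, v', w', hv', hw', hne'⟩
    exact (rankOne_eq_of_orthogonal hv.1 hw.1 hv'.1 hw'.1 (h03 _ _ hv hv') (h04 _ _ hv hw')
      (h13 _ _ hw hv') (h14 _ _ hw hw')).elim hne hne'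
  obtain ⟨v₀, hv₀⟩ := hVex 0 (by decide)
  obtain ⟨v₁, hv₁⟩ := hVex 1 (by decide)
  obtain ⟨v₃, hv₃⟩ := hVex 3 (by decide)
  obtain ⟨v₄, hv₄⟩ := hVex 4 (by decide)
  rcases hdich with h | h
  · exact hno v₀ hv₀.1
      (hself 0 (by decide) v₀ fun w hw => (h w v₁ hw hv₁).trans (h v₀ v₁ hv₀ hv₁).symm)
      (hself 1 (by decide) v₀ fun w hw => (h v₀ w hv₀ hw).symm)
      (hVr 0 2 (by decide) v₀ hv₀) (hVr 0 3 (by decide) v₀ hv₀) (hVr 0 4 (by decide) v₀ hv₀)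
  · exact hno v₄ hv₄.1
      (hVl 0 4 (by decide) v₄ hv₄) (hVl 1 4 (by decide) v₄ hv₄) (hVl 2 4 (by decide) v₄ hv₄)
      (hself 3 (by decide) v₄ fun w hw => h w v₄ hw hv₄)
      (hself 4 (by decide) v₄ fun w hw => (h v₃ w hv₃ hw).symm.trans (h v₃ v₄ hv₃ hv₄))

/-- The operator on the first factor obtained by fixing the indices of the second one. -/
def firstSlice {d : ℕ} {ι : Type*} (M : Matrix (Fin d × ι) (Fin d × ι) ℂ) (x y : ι) :
    Matrix (Fin d) (Fin d) ℂ := of fun a b => M (a, x) (b, y)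

lemma firstSlice_conjTranspose {d : ℕ} {ι : Type*} {M : Matrix (Fin d × ι) (Fin d × ι) ℂ}
    (hM : M.IsHermitian) (x y : ι) : (firstSlice M x y)ᴴ = firstSlice M y x := by
  ext a b
  exact hM.apply (a, y) (b, x)

lemma firstSlice_mul {d : ℕ} {ι : Type*} [Fintype ι] (M N : Matrix (Fin d × ι) (Fin d × ι) ℂ)
    (x y : ι) : firstSlice (M * N) x y = ∑ u, firstSlice M x u * firstSlice N u y := by
  ext a b
  simp [firstSlice, mul_apply, Matrix.sum_apply, Fintype.sum_prod_type_right]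

lemma commute_kronecker_one {d : ℕ} {ι : Type*} [Fintype ι] [DecidableEq ι]
    {M : Matrix (Fin d × ι) (Fin d × ι) ℂ} {P : Matrix (Fin d) (Fin d) ℂ}
    (h : ∀ x y, Commute (firstSlice M x y) P) : Commute M (P ⊗ₖ (1 : Matrix ι ι ℂ)) := by
  ext ⟨a, x⟩ ⟨b, y⟩
  simpa [firstSlice, mul_apply, Fintype.sum_prod_type, one_apply] using
    congrFun (congrFun (h x y).eq a) b

/-- The Hermitian matrices in the bicommutant of the slices of `M`. -/
def sliceHermitians {d : ℕ} {ι : Type*} (M : Matrix (Fin d × ι) (Fin d × ι) ℂ) :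
    Set (Matrix (Fin d) (Fin d) ℂ) :=
  {X | X.IsHermitian ∧ ∀ Y, (∀ x y, Commute (firstSlice M x y) Y) → Commute X Y}

lemma exists_firstSlice_eq_add_smul {d : ℕ} {ι : Type*} {M : Matrix (Fin d × ι) (Fin d × ι) ℂ}
    (hM : M.IsHermitian) (x y : ι) :
    ∃ X ∈ sliceHermitians M, ∃ Y ∈ sliceHermitians M,
      ∃ c e : ℂ, firstSlice M x y = c • X + e • Y := by
  have hxy := firstSlice_conjTranspose hM x y
  have hyx := firstSlice_conjTranspose hM y x
  refine ⟨firstSlice M x y + firstSlice M y x,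
    ⟨by rw [IsHermitian, conjTranspose_add, hxy, hyx, add_comm],
      fun Y hY => (hY x y).add_left (hY y x)⟩,
    Complex.I • (firstSlice M x y - firstSlice M y x),
    ⟨by simp [IsHermitian, hxy, hyx, ← smul_neg],
      fun Y hY => ((hY x y).sub_left (hY y x)).smul_left _⟩, 1 / 2, -(1 / 2) * Complex.I, ?_⟩
  rw [smul_smul, mul_assoc, Complex.I_mul_I]
  module

/-- `M` acts only on the first factor and on the particles in `S`. -/
structure IsLocalOn {d n : ℕ} {da : Fin n → ℕ}
    (M : Matrix (Fin d × ∀ j, Fin (da j)) (Fin d × ∀ j, Fin (da j)) ℂ) (S : Set (Fin n)) :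
    Prop where
  eq_zero : ∀ x y, ¬ (∀ j ∉ S, x j = y j) → firstSlice M x y = 0
  congr : ∀ x y x' y', (∀ j ∉ S, x j = y j) → (∀ j ∉ S, x' j = y' j) →
    (∀ j ∈ S, x j = x' j) → (∀ j ∈ S, y j = y' j) → firstSlice M x y = firstSlice M x' y'

lemma IsLocalOn.firstSlice_mul_eq {d n : ℕ} {da : Fin n → ℕ}
    {M N : Matrix (Fin d × ∀ j, Fin (da j)) (Fin d × ∀ j, Fin (da j)) ℂ} {S T : Set (Fin n)}
    (hM : IsLocalOn M S) (hN : IsLocalOn N T) (hST : Disjoint S T) {z w u : ∀ j, Fin (da j)}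
    (huS : ∀ j ∈ S, u j = w j) (hu : ∀ j ∉ S, u j = z j) :
    firstSlice (M * N) z w = firstSlice M z u * firstSlice N u w := by
  rw [firstSlice_mul]
  refine Finset.sum_eq_single u (fun t _ htu => ?_) (by simp)
  by_cases h1 : ∀ j ∉ S, z j = t j
  · by_cases h2 : ∀ j ∉ T, t j = w j
    · refine (htu (funext fun j => ?_)).elim
      by_cases hj : j ∈ S
      · rw [huS j hj, h2 j (hST.notMem_of_mem_left hj)]
      · rw [hu j hj, h1 j hj]
    · rw [hN.eq_zero t w h2, Matrix.mul_zero]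
  · rw [hM.eq_zero z t h1, Matrix.zero_mul]

/-- Commuting operators that share only the first factor have commuting slices. -/
lemma IsLocalOn.commute_firstSlice {d n : ℕ} {da : Fin n → ℕ}
    {M N : Matrix (Fin d × ∀ j, Fin (da j)) (Fin d × ∀ j, Fin (da j)) ℂ} {S T : Set (Fin n)}
    (hM : IsLocalOn M S) (hN : IsLocalOn N T) (hST : Disjoint S T) (h : Commute M N)
    (x y x' y' : ∀ j, Fin (da j)) : Commute (firstSlice M x y) (firstSlice N x' y') := by
  classical
  by_cases hxy : ∀ j ∉ S, x j = y j
  swap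
  · rw [hM.eq_zero x y hxy]
    exact Commute.zero_left _
  by_cases hxy' : ∀ j ∉ T, x' j = y' j
  swap
  · rw [hN.eq_zero x' y' hxy']
    exact Commute.zero_right _
  have hTS : ∀ j ∈ T, j ∉ S := fun j hj => hST.notMem_of_mem_right hj
  let mix (p r : ∀ j, Fin (da j)) : ∀ j, Fin (da j) := fun j => if j ∈ S then p j else r j
  have mixS : ∀ p r, ∀ j ∈ S, mix p r j = p j := fun p r j hj => if_pos hj
  have mixN : ∀ p r, ∀ j ∉ S, mix p r j = r j := fun p r j hj => if_neg hj
  have mixT : ∀ p, ∀ j ∉ T, mix p x' j = mix p y' j := fun p j hj => by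
    simp only [mix, hxy' j hj]
  have hMmix : ∀ r, firstSlice M (mix x r) (mix y r) = firstSlice M x y := fun r =>
    hM.congr _ _ _ _ (fun j hj => by rw [mixN _ _ j hj, mixN _ _ j hj]) hxy (mixS x r) (mixS y r)
  have hNmix : ∀ p, firstSlice N (mix p x') (mix p y') = firstSlice N x' y' := fun p =>
    hN.congr _ _ _ _ (mixT p) hxy' (fun j hj => mixN _ _ j (hTS j hj))
      fun j hj => mixN _ _ j (hTS j hj)
  have hMN := hM.firstSlice_mul_eq hN hST (z := mix x x') (w := mix y y') (u := mix y x')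
    (fun j hj => by rw [mixS _ _ j hj, mixS _ _ j hj])
    (fun j hj => by rw [mixN _ _ j hj, mixN _ _ j hj])
  have hNM := hN.firstSlice_mul_eq hM hST.symm (z := mix x x') (w := mix y y') (u := mix x y')
    (fun j hj => by rw [mixN _ _ j (hTS j hj), mixN _ _ j (hTS j hj)])
    (fun j hj => (mixT x j hj).symm)
  rw [hMmix, hNmix] at hMN hNM
  rw [Commute, SemiconjBy, ← hMN, ← hNM, h.eq]

/-- key step of Lemma 5.11.  Consider a qudit `q` with
`2 ≤ dim H_q ≤ 3` and six further distinct particles `a₁, …, a₆` of dimensions `da 0, …,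
da 5` (total space `H_q ⊗ H_{a₁} ⊗ ⋯ ⊗ H_{a₆}`, modeled on the index
`Fin dq × Π j : Fin 6, Fin (da j)`).  For `i : Fin 5` let `Hs i` be a self-adjoint operator
supported only on the factors `H_q, H_{a_{i+1}}, H_{a_{i+2}}` (a length-5 open operator path
on `q`).  If the five operators pairwise commute and each acts nontrivially on `H_q`, then
there is a subspace `S` of `H_q` with `0 ≠ S ≠ H_q` (given by its orthogonal projection `P`,
a nonzero, non-identity Hermitian idempotent) such that every `Hs i` commutes with `P ⊗ I`;
i.e. all five operators preserve the common nontrivial decomposition `H_q = S ⊕ S^⊥`. -/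
theorem length_five_path_forces_common_decomposition
    {dq : ℕ} (hdq2 : 2 ≤ dq) (hdq3 : dq ≤ 3) (da : Fin 6 → ℕ)
    (Hs : Fin 5 → Matrix (Fin dq × ∀ j, Fin (da j)) (Fin dq × ∀ j, Fin (da j)) ℂ)
    (hsa : ∀ i, (Hs i).IsHermitian)
    (hloc : ∀ i : Fin 5,
      ∃ h : Matrix (Fin dq × Fin (da i.castSucc) × Fin (da i.succ))
          (Fin dq × Fin (da i.castSucc) × Fin (da i.succ)) ℂ,
        ∀ a x b y, Hs i (a, x) (b, y) =
          if (∀ j : Fin 6, j ≠ i.castSucc → j ≠ i.succ → x j = y j) then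
            h (a, x i.castSucc, x i.succ) (b, y i.castSucc, y i.succ)
          else 0)
    (hcomm : ∀ i k, Commute (Hs i) (Hs k))
    (hnt : ∀ i : Fin 5, ¬ ∃ B : Matrix (∀ j, Fin (da j)) (∀ j, Fin (da j)) ℂ,
      ∀ a x b y, Hs i (a, x) (b, y) = (if a = b then (1 : ℂ) else 0) * B x y) :
    ∃ P : Matrix (Fin dq) (Fin dq) ℂ,
      P.IsHermitian ∧ P * P = P ∧ P ≠ 0 ∧ P ≠ 1 ∧
      ∀ i, Commute (Hs i)
        (P ⊗ₖ (1 : Matrix (∀ j, Fin (da j)) (∀ j, Fin (da j)) ℂ)) := by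
  have hlocal : ∀ i, IsLocalOn (Hs i) {i.castSucc, i.succ} := fun i => by
    obtain ⟨h, hh⟩ := hloc i
    have hiff : ∀ x y : ∀ j, Fin (da j),
        (∀ j ∉ ({i.castSucc, i.succ} : Set (Fin 6)), x j = y j) ↔
          ∀ j : Fin 6, j ≠ i.castSucc → j ≠ i.succ → x j = y j := by simp
    constructor
    · intro x y hxy
      ext a b
      exact (hh a x b y).trans (if_neg fun H => hxy ((hiff x y).mpr H))
    · intro x y x' y' hxy hxy' hx hy
      ext a b
      refine ((hh a x b y).trans (if_pos ((hiff x y).mp hxy))).trans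
        (Eq.trans ?_ ((hh a x' b y').trans (if_pos ((hiff x' y').mp hxy'))).symm)
      rw [hx _ (by simp), hx i.succ (by simp), hy _ (by simp), hy i.succ (by simp)]
  obtain ⟨v, hv, hvA⟩ := exists_common_rankOne hdq2 hdq3
    (fun i => sliceHermitians (Hs i))
    (fun i X hX => hX.1)
    (fun i k hik X hX Y hY => hX.2 Y fun x y => (hY.2 _ fun x' y' =>
      ((hlocal i).commute_firstSlice (hlocal k) (by
        simp only [Set.disjoint_insert_left, Set.disjoint_singleton_left, Set.mem_insert_iff,
          Set.mem_singleton_iff, Fin.ext_iff, Fin.val_castSucc, Fin.val_succ]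
        omega) (hcomm i k) x y x' y').symm).symm)
    (fun i => by
      by_contra! H
      have hscalar : ∀ x y, ∃ c : ℂ, firstSlice (Hs i) x y = c • 1 := fun x y => by
        obtain ⟨X, hX, Y, hY, c, e, hce⟩ := exists_firstSlice_eq_add_smul (hsa i) x y
        obtain ⟨r, hr⟩ := H X hX
        obtain ⟨t, ht⟩ := H Y hY
        exact ⟨c * r + e * t, by rw [hce, hr, ht, smul_smul, smul_smul, add_smul]⟩
      choose B hB using hscalar
      refine hnt i ⟨of B, fun a x b y => ?_⟩
      have := congrFun (congrFun (hB x y) a) b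
      simpa [firstSlice, one_apply, mul_comm] using this)
  have htr := trace_rankOne hv
  refine ⟨rankOne v, rankOne_isHermitian v, rankOne_mul_self hv, ?_, ?_, fun i => ?_⟩
  · intro h0
    simp [h0] at htr
  · intro h1
    rw [h1, trace_one, Fintype.card_fin] at htr
    have : dq = 1 := by exact_mod_cast htr
    omega
  · refine commute_kronecker_one fun x y => ?_
    obtain ⟨X, hX, Y, hY, c, e, hce⟩ := exists_firstSlice_eq_add_smul (hsa i) x y
    rw [hce]
    exact ((hvA i X hX).symm.smul_left c).add_left ((hvA i Y hY).symm.smul_left e)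
end
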